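/- Assume n > 2γ + 8. Then ∫_0^∞ ∫_{ℝⁿ} x_N^{3-2γ} |x̄|² |∇_{x̄} W₁(x̄, x_N)|² dx̄ dx_N = |S^{n-1}| · [ (1-γ²)·2(n+2)(5(n-1)(n-3) + (1-4γ²)) / (15(n-4)(n-2γ-4)(n+2γ-4)) ] · A₁ B₂, and ∫_0^∞ ∫_{ℝⁿ} x_N^{3-2γ} |x̄|² |∂_{x_N} W₁(x̄, x_N)|² dx̄ dx_N = |S^{n-1}| · [ 2(1-γ)(2-γ)(5(n-1)(n-2)(n-3) - R) / (15(n-4)(n-2γ-4)(n+2γ-4)) ] · A₁ B₂, where R = (1-2γ)(3n - 14 - 2γ(n+2)). -/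

import Mathlib

open MeasureTheory Real Filter Topology

noncomputable section

/-- The constant `c_{n,γ}` in the definition of the standard bubble. -/
def cng (n : ℕ) (γ : ℝ) : ℝ :=
  2 ^ (((n : ℝ) - 2 * γ) / 2) *
    (Real.Gamma (((n : ℝ) + 2 * γ) / 2) / Real.Gamma (((n : ℝ) - 2 * γ) / 2)) ^
      (((n : ℝ) - 2 * γ) / (4 * γ))

/-- The constant `p_{n,γ}` in the Poisson kernel. -/
def png (n : ℕ) (γ : ℝ) : ℝ :=
  Real.Gamma (((n : ℝ) + 2 * γ) / 2) / (Real.pi ^ ((n : ℝ) / 2) * Real.Gamma γ)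

/-- The bubble `w_{λ,σ}` on `ℝⁿ`. -/
def bubble (n : ℕ) (γ lam : ℝ) (σ : EuclideanSpace ℝ (Fin n))
    (x : EuclideanSpace ℝ (Fin n)) : ℝ :=
  cng n γ * (lam / (lam ^ 2 + ‖x - σ‖ ^ 2)) ^ (((n : ℝ) - 2 * γ) / 2)

/-- The extension `W_{λ,σ}` of the bubble to the upper half space, given by
convolution with the Poisson kernel. -/
def bubbleExt (n : ℕ) (γ lam : ℝ) (σ : EuclideanSpace ℝ (Fin n))
    (x : EuclideanSpace ℝ (Fin n)) (xN : ℝ) : ℝ :=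
  png n γ * ∫ ξ : EuclideanSpace ℝ (Fin n),
    xN ^ (2 * γ) / (‖x - ξ‖ ^ 2 + xN ^ 2) ^ (((n : ℝ) + 2 * γ) / 2) * bubble n γ lam σ ξ

/-- The modified Bessel function of the second kind `K_γ`. -/
def besselK (γ t : ℝ) : ℝ :=
  ∫ s in Set.Ioi (0 : ℝ), Real.exp (-t * Real.cosh s) * Real.cosh (γ * s)

/-- The function `φ(t) = (2^{1-γ}/Γ(γ)) t^γ K_γ(t)`. -/
def phiK (γ t : ℝ) : ℝ := (2 ^ (1 - γ) / Real.Gamma γ) * t ^ γ * besselK γ t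

/-- The constant `d₂`. -/
def dTwo (n : ℕ) (γ : ℝ) : ℝ :=
  2 * Real.Gamma (((n : ℝ) + 2 * γ) / 2) ^ (((n : ℝ) - 2 * γ) / (4 * γ)) /
    Real.Gamma (((n : ℝ) - 2 * γ) / 2) ^ (((n : ℝ) + 2 * γ) / (4 * γ))

/-- The radial profile `ŵ₁(ρ) = d₂ ρ^{-γ} K_γ(ρ)` of the Fourier transform of the
standard bubble. -/
def whatOne (n : ℕ) (γ ρ : ℝ) : ℝ := dTwo n γ * ρ ^ (-γ) * besselK γ ρ

/-- The constant `A₁ = ∫_0^∞ t^{1-2γ} φ(t)² dt`. -/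
def Aone (γ : ℝ) : ℝ := ∫ t in Set.Ioi (0 : ℝ), t ^ (1 - 2 * γ) * (phiK γ t) ^ 2

/-- The constant `B₂ = ∫_0^∞ ρ^{n-3+2γ} ŵ₁(ρ)² dρ`. -/
def Btwo (n : ℕ) (γ : ℝ) : ℝ :=
  ∫ ρ in Set.Ioi (0 : ℝ), ρ ^ ((n : ℝ) - 3 + 2 * γ) * (whatOne n γ ρ) ^ 2

/-- The total surface measure `|S^{n-1}|` of the unit sphere in `ℝⁿ`. -/
def sphereConst (n : ℕ) : ℝ := 2 * Real.pi ^ ((n : ℝ) / 2) / Real.Gamma ((n : ℝ) / 2)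

/-! ### Fubini and Laplace transforms -/

/-- Lebesgue measure on the half line `(0, ∞)`. -/
abbrev halfLine : Measure ℝ := volume.restrict (Set.Ioi 0)

lemma ae_halfLine_pos : ∀ᵐ t ∂halfLine, 0 < t := ae_restrict_mem measurableSet_Ioi

/-- Tonelli's theorem for Bochner integrals: only the inner integrals need to be finite. -/
lemma integral_integral_swap_of_nonneg {α β : Type*} [MeasurableSpace α] [MeasurableSpace β]
    {μ : Measure α} {ν : Measure β} [SFinite μ] [SFinite ν] {f : α → β → ℝ}
    (hm : AEStronglyMeasurable (Function.uncurry f) (μ.prod ν))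
    (h0 : ∀ᵐ x ∂μ, ∀ᵐ y ∂ν, 0 ≤ f x y) (h0' : ∀ᵐ y ∂ν, ∀ᵐ x ∂μ, 0 ≤ f x y)
    (h1 : ∀ᵐ x ∂μ, Integrable (fun y => f x y) ν)
    (h2 : ∀ᵐ y ∂ν, Integrable (fun x => f x y) μ) :
    ∫ x, ∫ y, f x y ∂ν ∂μ = ∫ y, ∫ x, f x y ∂μ ∂ν := by
  rw [integral_eq_lintegral_of_nonneg_ae (h0.mono fun x hx => integral_nonneg_of_ae hx)
      hm.integral_prod_right',
    integral_eq_lintegral_of_nonneg_ae (h0'.mono fun x hx => integral_nonneg_of_ae hx)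
      hm.prod_swap.integral_prod_right']
  congr 1
  have e1 : ∫⁻ x, ENNReal.ofReal (∫ y, f x y ∂ν) ∂μ = ∫⁻ x, ∫⁻ y, ENNReal.ofReal (f x y) ∂ν ∂μ :=
    lintegral_congr_ae <| by
      filter_upwards [h0, h1] with x hx hx1 using ofReal_integral_eq_lintegral_ofReal hx1 hx
  have e2 : ∫⁻ y, ENNReal.ofReal (∫ x, f x y ∂μ) ∂ν = ∫⁻ y, ∫⁻ x, ENNReal.ofReal (f x y) ∂μ ∂ν :=
    lintegral_congr_ae <| by
      filter_upwards [h0', h2] with x hx hx1 using ofReal_integral_eq_lintegral_ofReal hx1 hx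
  exact e1.trans ((lintegral_lintegral_swap hm.aemeasurable.ennreal_ofReal).trans e2.symm)

lemma integrable_rpow_mul_exp {q v : ℝ} (hq : 0 < q) (hv : 0 < v) :
    Integrable (fun l : ℝ => l ^ (q - 1) * rexp (-(v * l))) halfLine := by
  have := integrableOn_rpow_mul_exp_neg_mul_rpow (s := q - 1) (p := 1) (b := v)
    (by linarith) (by norm_num) hv
  simpa [IntegrableOn] using this

lemma integral_rpow_mul_exp {q v : ℝ} (hq : 0 < q) (hv : 0 < v) :
    ∫ l, l ^ (q - 1) * rexp (-(v * l)) ∂halfLine = Real.Gamma q * v ^ (-q) := by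
  rw [integral_rpow_mul_exp_neg_mul_Ioi hq hv, one_div, inv_rpow hv.le, rpow_neg hv.le, mul_comm]

/-- The Mellin transform of a product of two Laplace transforms. -/
lemma mellin_laplace_mul_laplace {α β : Type*} [MeasurableSpace α] [MeasurableSpace β]
    {μ : Measure α} {ν : Measure β} [SFinite μ] [SFinite ν] {g₁ v₁ : α → ℝ} {g₂ v₂ : β → ℝ} {q : ℝ}
    (hq : 0 < q) (hg₁ : Measurable g₁) (hg₂ : Measurable g₂) (hv₁ : Measurable v₁)
    (hv₂ : Measurable v₂) (hp₁ : ∀ᵐ a ∂μ, 0 < v₁ a) (hp₂ : ∀ᵐ b ∂ν, 0 < v₂ b)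
    (hi : Integrable (fun z : α × β => g₁ z.1 * g₂ z.2 * (v₁ z.1 + v₂ z.2) ^ (-q)) (μ.prod ν)) :
    Integrable (fun l => l ^ (q - 1) * ((∫ a, g₁ a * rexp (-(l * v₁ a)) ∂μ) *
      ∫ b, g₂ b * rexp (-(l * v₂ b)) ∂ν)) halfLine ∧
    ∫ l, l ^ (q - 1) * ((∫ a, g₁ a * rexp (-(l * v₁ a)) ∂μ) *
      ∫ b, g₂ b * rexp (-(l * v₂ b)) ∂ν) ∂halfLine =
    Real.Gamma q * ∫ z : α × β, g₁ z.1 * g₂ z.2 * (v₁ z.1 + v₂ z.2) ^ (-q) ∂(μ.prod ν) := by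
  set F : ℝ → α × β → ℝ := fun l z =>
    l ^ (q - 1) * ((g₁ z.1 * rexp (-(l * v₁ z.1))) * (g₂ z.2 * rexp (-(l * v₂ z.2)))) with hF
  have hFe : ∀ l z, F l z = g₁ z.1 * g₂ z.2 * (l ^ (q - 1) * rexp (-((v₁ z.1 + v₂ z.2) * l))) := by
    intro l z
    simp only [hF]
    rw [show -((v₁ z.1 + v₂ z.2) * l) = -(l * v₁ z.1) + -(l * v₂ z.2) by ring, Real.exp_add]
    ring
  have hpos : ∀ᵐ z ∂(μ.prod ν), 0 < v₁ z.1 + v₂ z.2 := by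
    filter_upwards [Measure.quasiMeasurePreserving_fst.ae hp₁,
      Measure.quasiMeasurePreserving_snd.ae hp₂] with z h1 h2 using add_pos h1 h2
  have hFm : Measurable (Function.uncurry F) := by
    simp only [hF, Function.uncurry_def]
    fun_prop
  have hint : Integrable (Function.uncurry F) (halfLine.prod (μ.prod ν)) := by
    rw [integrable_prod_iff' hFm.aestronglyMeasurable]
    constructor
    · filter_upwards [hpos] with z hz
      simp only [Function.uncurry_apply_pair, hFe]
      exact (integrable_rpow_mul_exp hq hz).const_mul _
    · refine (hi.norm.const_mul (Real.Gamma q)).congr ?_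
      filter_upwards [hpos] with z hz
      simp only [Function.uncurry_apply_pair, hFe]
      rw [integral_congr_ae (g := fun l => ‖g₁ z.1 * g₂ z.2‖ *
        (l ^ (q - 1) * rexp (-((v₁ z.1 + v₂ z.2) * l)))), integral_const_mul,
        integral_rpow_mul_exp hq hz]
      · rw [norm_mul, Real.norm_of_nonneg (rpow_nonneg hz.le _)]
        ring
      · filter_upwards [ae_halfLine_pos] with l hl
        rw [norm_mul, Real.norm_of_nonneg (r := l ^ (q - 1) * _) (by positivity)]
  have hin : ∀ l, ∫ z, F l z ∂(μ.prod ν) = l ^ (q - 1) * ((∫ a, g₁ a * rexp (-(l * v₁ a)) ∂μ) *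
      ∫ b, g₂ b * rexp (-(l * v₂ b)) ∂ν) := by
    intro l
    simp only [hF]
    rw [integral_const_mul, integral_prod_mul (fun a => g₁ a * rexp (-(l * v₁ a)))
      (fun b => g₂ b * rexp (-(l * v₂ b)))]
  refine ⟨hint.integral_prod_left.congr (.of_forall hin), ?_⟩
  rw [← integral_congr_ae (.of_forall hin), integral_integral_swap hint, ← integral_const_mul]
  refine integral_congr_ae ?_
  filter_upwards [hpos] with z hz
  simp only [hFe]
  rw [integral_const_mul, integral_rpow_mul_exp hq hz]
  ring

/-- Changing `v` to `1 / v` in the Mellin transform of a squared Laplace transform. -/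
lemma mellin_sq_laplace_inv {α : Type*} [MeasurableSpace α] {μ : Measure α} [SFinite μ]
    {h θ : α → ℝ} {q : ℝ} (hq : 0 < q) (hh : Measurable h) (hθ : Measurable θ)
    (hp : ∀ᵐ a ∂μ, 0 < θ a) (hi : Integrable (fun a => h a * θ a ^ (q / 2)) μ) :
    ∫ r, r ^ (q - 1) * (∫ a, h a * rexp (-(r * (θ a)⁻¹)) ∂μ) ^ 2 ∂halfLine =
    ∫ l, l ^ (q - 1) * (∫ a, h a * θ a ^ q * rexp (-(l * θ a)) ∂μ) ^ 2 ∂halfLine := by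
  have hpos : ∀ᵐ z ∂(μ.prod μ), 0 < θ z.1 ∧ 0 < θ z.2 := by
    filter_upwards [Measure.quasiMeasurePreserving_fst.ae hp,
      Measure.quasiMeasurePreserving_snd.ae hp] with z h1 h2 using ⟨h1, h2⟩
  have hbase : Integrable (fun z : α × α => (h z.1 * θ z.1 ^ q) * (h z.2 * θ z.2 ^ q) *
      (θ z.1 + θ z.2) ^ (-q)) (μ.prod μ) := by
    refine (hi.norm.mul_prod hi.norm).mono' (by fun_prop) ?_
    filter_upwards [hpos] with z ⟨h1, h2⟩
    have hs : 0 < θ z.1 + θ z.2 := add_pos h1 h2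
    have key : (θ z.1 ^ (q / 2)) * (θ z.2 ^ (q / 2)) ≤ (θ z.1 + θ z.2) ^ q := by
      rw [show q = q / 2 + q / 2 by ring, rpow_add hs]
      simp only [add_halves]
      gcongr <;> linarith
    simp only [norm_mul, Real.norm_eq_abs, abs_of_pos (rpow_pos_of_pos h1 _),
      abs_of_pos (rpow_pos_of_pos h2 _), abs_of_pos (rpow_pos_of_pos hs _)]
    have e1 : θ z.1 ^ q = θ z.1 ^ (q / 2) * θ z.1 ^ (q / 2) := by
      rw [← rpow_add h1, add_halves]
    have e2 : θ z.2 ^ q = θ z.2 ^ (q / 2) * θ z.2 ^ (q / 2) := by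
      rw [← rpow_add h2, add_halves]
    rw [rpow_neg hs.le, ← div_eq_mul_inv, div_le_iff₀ (by positivity), e1, e2]
    calc _ = |h z.1| * θ z.1 ^ (q / 2) * (|h z.2| * θ z.2 ^ (q / 2)) *
          ((θ z.1 ^ (q / 2)) * (θ z.2 ^ (q / 2))) := by ring
      _ ≤ _ := by gcongr
  have heq : (fun z : α × α => (h z.1 * θ z.1 ^ q) * (h z.2 * θ z.2 ^ q) *
      (θ z.1 + θ z.2) ^ (-q)) =ᵐ[μ.prod μ]
      fun z => h z.1 * h z.2 * ((θ z.1)⁻¹ + (θ z.2)⁻¹) ^ (-q) := by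
    filter_upwards [hpos] with z ⟨h1, h2⟩
    have hs : 0 < θ z.1 + θ z.2 := add_pos h1 h2
    rw [show (θ z.1)⁻¹ + (θ z.2)⁻¹ = (θ z.1 + θ z.2) * (θ z.1 * θ z.2)⁻¹ by field_simp; ring,
      mul_rpow hs.le (by positivity), inv_rpow (by positivity), rpow_neg (by positivity) q,
      rpow_neg (by positivity) q, inv_inv, mul_rpow h1.le h2.le]
    ring
  have a1 := (mellin_laplace_mul_laplace (μ := μ) (ν := μ) hq hh hh hθ.inv hθ.inv
    (hp.mono fun _ h => inv_pos.2 h) (hp.mono fun _ h => inv_pos.2 h) (hbase.congr heq)).2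
  have a2 := (mellin_laplace_mul_laplace (μ := μ) (ν := μ) (g₁ := fun a => h a * θ a ^ q)
    (g₂ := fun a => h a * θ a ^ q) hq (by fun_prop) (by fun_prop) hθ hθ hp hp hbase).2
  simp only [sq]
  simp only [Pi.inv_apply] at a1
  rw [a1, a2, integral_congr_ae heq]

/-! ### The integrals `∫ s ^ (a - 1) e ^ (-s - y / s) ds` -/

/-- The integral `∫_0^∞ s ^ (a - 1) e ^ (-s - y / s) ds = 2 y ^ (a / 2) K_a(2 √y)`. -/
def besselInt (a y : ℝ) : ℝ := ∫ s, s ^ (a - 1) * rexp (-s) * rexp (-(y * s⁻¹)) ∂halfLine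

lemma integrable_besselKernel (a : ℝ) {c y : ℝ} (hc : 0 < c) (hy : 0 < y) :
    Integrable (fun s : ℝ => s ^ (a - 1) * rexp (-(c * s)) * rexp (-(y * s⁻¹))) halfLine := by
  obtain ⟨k, hk⟩ := exists_nat_gt (-a)
  have hak : 0 < a + k := by linarith
  refine ((integrable_rpow_mul_exp hak hc).const_mul (k.factorial / y ^ k)).mono' (by fun_prop) ?_
  filter_upwards [ae_halfLine_pos] with s hs
  rw [Real.norm_of_nonneg (by positivity)]
  have h1 := pow_div_factorial_le_exp (y * s⁻¹) (by positivity) k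
  have h2 : rexp (-(y * s⁻¹)) ≤ k.factorial / y ^ k * s ^ k := by
    rw [Real.exp_neg, inv_le_comm₀ (exp_pos _) (by positivity)]
    refine le_trans (le_of_eq ?_) h1
    rw [mul_pow, inv_pow]
    field_simp
  rw [show a + k - 1 = (a - 1) + k by ring, rpow_add_natCast hs.ne']
  calc _ ≤ s ^ (a - 1) * rexp (-(c * s)) * (k.factorial / y ^ k * s ^ k) := by gcongr
    _ = _ := by ring

lemma measurable_besselInt (a : ℝ) : Measurable (besselInt a) := by
  have : Measurable (Function.uncurry fun y s : ℝ =>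
      s ^ (a - 1) * rexp (-s) * rexp (-(y * s⁻¹))) := by
    simp only [Function.uncurry_def]
    fun_prop
  exact this.stronglyMeasurable.integral_prod_right.measurable

lemma integral_besselKernel (a : ℝ) {c : ℝ} (hc : 0 < c) (y : ℝ) :
    ∫ s, s ^ (a - 1) * rexp (-(c * s)) * rexp (-(y * s⁻¹)) ∂halfLine =
      c ^ (-a) * besselInt a (c * y) := by
  have h := integral_comp_mul_left_Ioi
    (fun s : ℝ => s ^ (a - 1) * rexp (-s) * rexp (-(c * y * s⁻¹))) 0 hc
  rw [mul_zero, smul_eq_mul] at h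
  rw [besselInt, ← mul_right_inj' (inv_ne_zero hc.ne'), mul_left_comm, ← h, ← integral_const_mul,
    ← integral_const_mul]
  refine integral_congr_ae ?_
  filter_upwards [ae_halfLine_pos] with s hs
  rw [mul_rpow hc.le hs.le, show a - 1 = -(-a) - 1 by ring, rpow_sub_one hc.ne' (- -a),
    rpow_neg hc.le (-a), show c * y * (c * s)⁻¹ = y * s⁻¹ by field_simp]
  have := (rpow_pos_of_pos hc (-a)).ne'
  field_simp

/-- The Beta integral over the half line. -/
lemma integral_rpow_mul_one_add_rpow {q c : ℝ} (hq : 0 < q) (hc : q < c) :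
    ∫ l, l ^ (q - 1) * (1 + l) ^ (-c) ∂halfLine =
      Real.Gamma q * Real.Gamma (c - q) / Real.Gamma c := by
  have hc0 : 0 < c := hq.trans hc
  have hG := Gamma_pos_of_pos hc0
  have hi1 : ∀ l > 0, Integrable
      (fun x : ℝ => l ^ (q - 1) * (x ^ (c - 1) * rexp (-((1 + l) * x)))) halfLine :=
    fun l hl => (integrable_rpow_mul_exp hc0 (by linarith)).const_mul _
  have e2 : ∀ l x : ℝ, l ^ (q - 1) * (x ^ (c - 1) * rexp (-((1 + l) * x))) =
      (x ^ (c - 1) * rexp (-(1 * x))) * (l ^ (q - 1) * rexp (-(x * l))) := by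
    intro l x
    rw [show -((1 + l) * x) = -(1 * x) + -(x * l) by ring, Real.exp_add]
    ring
  have hsw := integral_integral_swap_of_nonneg (μ := halfLine) (ν := halfLine)
    (f := fun l x : ℝ => l ^ (q - 1) * (x ^ (c - 1) * rexp (-((1 + l) * x))))
    (by apply Measurable.aestronglyMeasurable; simp only [Function.uncurry_def]; fun_prop)
    (by filter_upwards [ae_halfLine_pos] with l hl
        filter_upwards [ae_halfLine_pos] with x hx
        positivity)
    (by filter_upwards [ae_halfLine_pos] with l hl
        filter_upwards [ae_halfLine_pos] with x hx
        positivity)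
    (by filter_upwards [ae_halfLine_pos] with l hl using hi1 l hl)
    (by filter_upwards [ae_halfLine_pos] with x hx
        simp only [e2]
        exact (integrable_rpow_mul_exp hq hx).const_mul _)
  have hl : ∫ l, (∫ x, l ^ (q - 1) * (x ^ (c - 1) * rexp (-((1 + l) * x))) ∂halfLine) ∂halfLine =
      Real.Gamma c * ∫ l, l ^ (q - 1) * (1 + l) ^ (-c) ∂halfLine := by
    rw [← integral_const_mul]
    refine integral_congr_ae ?_
    filter_upwards [ae_halfLine_pos] with l hl
    rw [integral_const_mul, integral_rpow_mul_exp hc0 (by linarith)]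
    ring
  have hr : ∫ x, (∫ l, l ^ (q - 1) * (x ^ (c - 1) * rexp (-((1 + l) * x))) ∂halfLine) ∂halfLine =
      Real.Gamma q * Real.Gamma (c - q) := by
    have := integral_rpow_mul_exp (sub_pos.2 hc) one_pos
    rw [one_rpow, mul_one] at this
    rw [← this, ← integral_const_mul]
    refine integral_congr_ae ?_
    filter_upwards [ae_halfLine_pos] with x hx
    simp only [e2]
    rw [integral_const_mul, integral_rpow_mul_exp hq hx, show c - q - 1 = c - 1 + -q by ring,
      rpow_add hx]
    ring
  rw [eq_div_iff hG.ne', mul_comm, ← hl, hsw, hr]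

lemma integrable_rpow_mul_rpow_mul_add_rpow {q a b : ℝ} (hq : 0 < q) (ha : 0 < a) (hb : 0 < b)
    (hab : q < a + b) :
    Integrable (fun z : ℝ × ℝ => (z.1 ^ (a - 1) * rexp (-z.1)) * (z.2 ^ (b - 1) * rexp (-z.2)) *
      (z.1 + z.2) ^ (-q)) (halfLine.prod halfLine) := by
  have hs : 0 < a + b := by linarith
  have h1 : 0 < a - q * (a / (a + b)) := by
    rw [sub_pos, mul_div_assoc', div_lt_iff₀ hs]; nlinarith
  have h2 : 0 < b - q * (b / (a + b)) := by
    rw [sub_pos, mul_div_assoc', div_lt_iff₀ hs]; nlinarith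
  refine ((integrable_rpow_mul_exp h1 one_pos).mul_prod
    (integrable_rpow_mul_exp h2 one_pos)).mono' (by fun_prop) ?_
  filter_upwards [Measure.quasiMeasurePreserving_fst.ae ae_halfLine_pos,
      Measure.quasiMeasurePreserving_snd.ae ae_halfLine_pos] with z hz1 hz2
  rw [Real.norm_of_nonneg (by positivity)]
  have hz : 0 < z.1 + z.2 := by positivity
  have e : -q = -(q * (a / (a + b))) + -(q * (b / (a + b))) := by field_simp; ring
  rw [show a - q * (a / (a + b)) - 1 = (a - 1) + -(q * (a / (a + b))) by ring,
    show b - q * (b / (a + b)) - 1 = (b - 1) + -(q * (b / (a + b))) by ring, rpow_add hz1,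
    rpow_add hz2, e, rpow_add hz, one_mul, one_mul]
  have k1 : (z.1 + z.2) ^ (-(q * (a / (a + b)))) ≤ z.1 ^ (-(q * (a / (a + b)))) :=
    rpow_le_rpow_of_nonpos hz1 (by linarith) (neg_nonpos.2 (by positivity))
  have k2 : (z.1 + z.2) ^ (-(q * (b / (a + b)))) ≤ z.2 ^ (-(q * (b / (a + b)))) :=
    rpow_le_rpow_of_nonpos hz2 (by linarith) (neg_nonpos.2 (by positivity))
  calc _ ≤ (z.1 ^ (a - 1) * rexp (-z.1)) * (z.2 ^ (b - 1) * rexp (-z.2)) *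
      (z.1 ^ (-(q * (a / (a + b)))) * z.2 ^ (-(q * (b / (a + b))))) := by gcongr
    _ = _ := by ring

lemma integral_rpow_mul_rpow_mul_add_rpow {q a b : ℝ} (hq : 0 < q) (ha : 0 < a) (hb : 0 < b)
    (hab : q < a + b) :
    ∫ z : ℝ × ℝ, (z.1 ^ (a - 1) * rexp (-z.1)) * (z.2 ^ (b - 1) * rexp (-z.2)) *
      (z.1 + z.2) ^ (-q) ∂(halfLine.prod halfLine) =
      Real.Gamma a * Real.Gamma b * Real.Gamma (a + b - q) / Real.Gamma (a + b) := by
  have h := (mellin_laplace_mul_laplace (μ := halfLine) (ν := halfLine)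
    (g₁ := fun s => s ^ (a - 1) * rexp (-s)) (g₂ := fun s => s ^ (b - 1) * rexp (-s))
    (v₁ := fun s => s) (v₂ := fun s => s)
    hq (by fun_prop) (by fun_prop) measurable_id measurable_id ae_halfLine_pos ae_halfLine_pos
    (integrable_rpow_mul_rpow_mul_add_rpow hq ha hb hab)).2
  have hG := Gamma_pos_of_pos hq
  have hin : ∀ (a : ℝ), 0 < a → ∀ l : ℝ, 0 < l →
      ∫ s, s ^ (a - 1) * rexp (-s) * rexp (-(l * s)) ∂halfLine =
        Real.Gamma a * (1 + l) ^ (-a) := by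
    intro a ha l hl
    rw [← integral_rpow_mul_exp ha (by linarith)]
    congr 1 with s
    rw [mul_assoc, ← Real.exp_add]
    ring_nf
  rw [integral_congr_ae (g := fun l => Real.Gamma a * Real.Gamma b *
    (l ^ (q - 1) * (1 + l) ^ (-(a + b)))), integral_const_mul,
    integral_rpow_mul_one_add_rpow hq hab] at h
  · rw [← mul_right_inj' hG.ne', ← h]
    ring
  · filter_upwards [ae_halfLine_pos] with l hl
    rw [hin a ha l hl, hin b hb l hl, neg_add, rpow_add (by linarith)]
    ring

/-- The Mellin transform of a product of two Bessel functions. -/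
lemma mellin_besselInt_mul_besselInt {q a b : ℝ} (hq : 0 < q) (ha : 0 < a + q) (hb : 0 < b + q)
    (hab : 0 < a + b + q) :
    Integrable (fun l => l ^ (q - 1) * (besselInt a l * besselInt b l)) halfLine ∧
    ∫ l, l ^ (q - 1) * (besselInt a l * besselInt b l) ∂halfLine =
      Real.Gamma q * Real.Gamma (a + q) * Real.Gamma (b + q) * Real.Gamma (a + b + q) /
        Real.Gamma (a + b + 2 * q) := by
  have heq : (fun z : ℝ × ℝ => (z.1 ^ (a + q - 1) * rexp (-z.1)) *
      (z.2 ^ (b + q - 1) * rexp (-z.2)) * (z.1 + z.2) ^ (-q)) =ᵐ[halfLine.prod halfLine]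
      fun z => (z.1 ^ (a - 1) * rexp (-z.1)) * (z.2 ^ (b - 1) * rexp (-z.2)) *
        (z.1⁻¹ + z.2⁻¹) ^ (-q) := by
    filter_upwards [Measure.quasiMeasurePreserving_fst.ae ae_halfLine_pos,
      Measure.quasiMeasurePreserving_snd.ae ae_halfLine_pos] with z h1 h2
    have hs : 0 < z.1 + z.2 := add_pos h1 h2
    rw [show z.1⁻¹ + z.2⁻¹ = (z.1 + z.2) * (z.1 * z.2)⁻¹ by field_simp; ring,
      mul_rpow hs.le (by positivity), inv_rpow (by positivity),
      rpow_neg (x := z.1 * z.2) (by positivity) q,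
      inv_inv, mul_rpow h1.le h2.le, show a + q - 1 = (a - 1) + q by ring, rpow_add h1,
      show b + q - 1 = (b - 1) + q by ring, rpow_add h2]
    ring
  have hinv : ∀ᵐ s ∂halfLine, (0 : ℝ) < s⁻¹ := ae_halfLine_pos.mono fun _ => inv_pos.2
  have h := mellin_laplace_mul_laplace (μ := halfLine) (ν := halfLine)
    (g₁ := fun s => s ^ (a - 1) * rexp (-s)) (g₂ := fun s => s ^ (b - 1) * rexp (-s))
    (v₁ := fun s => s⁻¹) (v₂ := fun s => s⁻¹)
    hq (by fun_prop) (by fun_prop) (by fun_prop) (by fun_prop) hinv hinv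
    ((integrable_rpow_mul_rpow_mul_add_rpow hq ha hb (by linarith)).congr heq)
  refine ⟨h.1, ?_⟩
  have h2 := h.2
  rw [← integral_congr_ae heq,
    integral_rpow_mul_rpow_mul_add_rpow hq ha hb (by linarith)] at h2
  simp only [besselInt]
  rw [h2, show a + q + (b + q) - q = a + b + q by ring,
    show a + q + (b + q) = a + b + 2 * q by ring]
  ring

/-- A quadratic change of variables on the half line. -/
lemma integral_rpow_mul_comp_mul_sq (p : ℝ) {c : ℝ} (hc : 0 < c) (g : ℝ → ℝ) :
    ∫ t, t ^ p * g (t ^ 2 * c) ∂halfLine =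
      1 / 2 * c ^ (-((p + 1) / 2)) * ∫ y, y ^ ((p - 1) / 2) * g y ∂halfLine := by
  have h1 := integral_comp_rpow_Ioi_of_pos (g := fun y => y ^ ((p - 1) / 2) * g (c * y))
    (p := 2) two_pos
  have h2 := integral_comp_mul_left_Ioi (fun y => y ^ ((p - 1) / 2) * g y) 0 hc
  rw [mul_zero, smul_eq_mul] at h2
  have h3 : ∫ y, (c * y) ^ ((p - 1) / 2) * g (c * y) ∂halfLine =
      c ^ ((p - 1) / 2) * ∫ y, y ^ ((p - 1) / 2) * g (c * y) ∂halfLine := by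
    rw [← integral_const_mul]
    refine integral_congr_ae ?_
    filter_upwards [ae_halfLine_pos] with y hy
    rw [mul_rpow hc.le hy.le]
    ring
  have h4 : ∫ t, t ^ p * g (t ^ 2 * c) ∂halfLine =
      1 / 2 * ∫ y, y ^ ((p - 1) / 2) * g (c * y) ∂halfLine := by
    rw [← h1, ← integral_const_mul]
    refine integral_congr_ae ?_
    filter_upwards [ae_halfLine_pos] with t ht
    rw [← rpow_mul ht.le, show (2 : ℝ) - 1 = 1 by norm_num, rpow_one, rpow_two, smul_eq_mul,
      show p = 1 + 2 * ((p - 1) / 2) by ring, rpow_add ht, rpow_one, mul_comm c]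
    ring_nf
  have hcp := rpow_pos_of_pos hc ((p - 1) / 2)
  rw [h4, show -((p + 1) / 2) = -((p - 1) / 2) - 1 by ring, rpow_sub_one hc.ne', rpow_neg hc.le]
  rw [h3] at h2
  field_simp
  field_simp at h2
  linarith

lemma integrable_rpow_mul_comp_mul_sq (p : ℝ) {c : ℝ} (hc : 0 < c) {g : ℝ → ℝ}
    (hg : Integrable (fun y => y ^ ((p - 1) / 2) * g y) halfLine) :
    Integrable (fun t => t ^ p * g (t ^ 2 * c)) halfLine := by
  have h1 := (integrableOn_Ioi_comp_rpow_iff (fun y => y ^ ((p - 1) / 2) * g (c * y))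
    (p := 2) two_ne_zero)
  have h2 := (integrableOn_Ioi_comp_mul_left_iff (fun y => y ^ ((p - 1) / 2) * g y) 0 hc).2
    (by rwa [mul_zero])
  have h3 : IntegrableOn (fun y => y ^ ((p - 1) / 2) * g (c * y)) (Set.Ioi 0) := by
    refine (h2.const_mul (c ^ (-((p - 1) / 2)))).congr ?_
    filter_upwards [ae_halfLine_pos] with y hy
    rw [mul_rpow hc.le hy.le, ← mul_assoc, ← mul_assoc, ← rpow_add hc, neg_add_cancel, rpow_zero,
      one_mul]
  refine ((h1.2 h3).const_mul (1 / 2)).congr ?_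
  filter_upwards [ae_halfLine_pos] with t ht
  rw [← rpow_mul ht.le, show (2 : ℝ) - 1 = 1 by norm_num, rpow_one, rpow_two, smul_eq_mul,
    show p = 1 + 2 * ((p - 1) / 2) by ring, rpow_add ht, rpow_one, mul_comm c, abs_two]
  ring_nf

lemma besselK_eq (γ : ℝ) {t : ℝ} (ht : 0 < t) :
    besselK γ t = 1 / 2 * (t / 2) ^ (-γ) * besselInt γ (t ^ 2 * (1 / 4)) := by
  set g : ℝ → ℝ := fun s => s ^ (γ - 1) * rexp (-s) * rexp (-(t ^ 2 * (1 / 4) * s⁻¹)) with hg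
  set f : ℝ → ℝ := fun x => rexp (-t * cosh x) * rexp (γ * x) with hf
  have himg : (fun x => t / 2 * rexp x) '' Set.univ = Set.Ioi 0 := by
    ext s
    simp only [Set.image_univ, Set.mem_range, Set.mem_Ioi]
    constructor
    · rintro ⟨x, rfl⟩
      positivity
    · intro hs
      exact ⟨Real.log (s / (t / 2)), by rw [Real.exp_log (by positivity)]; field_simp⟩
  have hd : ∀ x ∈ Set.univ, HasDerivWithinAt (fun x => t / 2 * rexp x) (t / 2 * rexp x) Set.univ x :=
    fun x _ => ((Real.hasDerivAt_exp x).const_mul _).hasDerivWithinAt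
  have hinj : Set.InjOn (fun x => t / 2 * rexp x) Set.univ := by
    intro x _ y _ h
    simpa [ht.ne'] using h
  have hgf : ∀ x, |t / 2 * rexp x| • g (t / 2 * rexp x) = (t / 2) ^ γ * f x := by
    intro x
    have hp : 0 < t / 2 * rexp x := by positivity
    simp only [hg, hf]
    rw [abs_of_pos hp, smul_eq_mul, rpow_sub_one hp.ne', mul_rpow (by positivity) (exp_pos _).le,
      ← Real.exp_mul, cosh_eq, mul_comm x γ,
      show -t * ((rexp x + rexp (-x)) / 2) = -(t / 2 * rexp x) +
        -(t ^ 2 * (1 / 4) * (t / 2 * rexp x)⁻¹) by rw [Real.exp_neg x]; field_simp; ring, Real.exp_add]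
    field_simp
  have hint : Integrable f := by
    have h1 : IntegrableOn g ((fun x => t / 2 * rexp x) '' Set.univ) := by
      rw [himg]
      have := integrable_besselKernel γ one_pos (y := t ^ 2 * (1 / 4)) (by positivity)
      simp only [one_mul] at this
      exact this
    rw [integrableOn_image_iff_integrableOn_abs_deriv_smul MeasurableSet.univ hd hinj,
      integrableOn_univ] at h1
    simp only [hgf] at h1
    refine (h1.const_mul ((t / 2) ^ (-γ))).congr (.of_forall fun x => ?_)
    simp only
    rw [← mul_assoc, ← rpow_add (by positivity), neg_add_cancel, rpow_zero, one_mul]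
  have hval : besselInt γ (t ^ 2 * (1 / 4)) = (t / 2) ^ γ * ∫ x, f x := by
    have := integral_image_eq_integral_abs_deriv_smul MeasurableSet.univ hd hinj g
    rw [himg, Measure.restrict_univ] at this
    rw [besselInt, this, ← integral_const_mul]
    exact integral_congr_ae (.of_forall hgf)
  have hsum : ∫ x, f x = 2 * besselK γ t := by
    rw [← intervalIntegral.integral_Iic_add_Ioi (b := 0) hint.integrableOn hint.integrableOn,
      ← neg_zero, ← integral_comp_neg_Ioi, neg_zero,
      ← integral_add hint.comp_neg.integrableOn hint.integrableOn, besselK, ← integral_const_mul]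
    congr 1 with x
    simp only [hf, cosh_neg]
    rw [cosh_eq (γ * x), mul_neg]
    ring
  rw [hval, hsum, rpow_neg (by positivity)]
  have := (rpow_pos_of_pos (half_pos ht) γ).ne'
  field_simp

lemma Aone_eq {γ : ℝ} (hγ : 0 < γ) :
    Aone γ = 2 ^ (1 - 2 * γ) / Real.Gamma γ ^ 2 *
      ∫ y, y ^ (-γ) * (besselInt γ y * besselInt γ y) ∂halfLine := by
  have hG := Gamma_pos_of_pos hγ
  have h := integral_rpow_mul_comp_mul_sq (1 - 2 * γ) (c := 1 / 4) (by norm_num)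
    (fun y => besselInt γ y * besselInt γ y)
  rw [show (1 - 2 * γ - 1) / 2 = -γ by ring] at h
  have h2 : Aone γ = 1 / Real.Gamma γ ^ 2 *
      ∫ t, t ^ (1 - 2 * γ) * (besselInt γ (t ^ 2 * (1 / 4)) * besselInt γ (t ^ 2 * (1 / 4)))
        ∂halfLine := by
    rw [Aone, ← integral_const_mul]
    refine integral_congr_ae ?_
    filter_upwards [ae_halfLine_pos] with t ht
    rw [phiK, besselK_eq γ ht, div_rpow ht.le two_pos.le, rpow_neg ht.le, rpow_neg two_pos.le,
      rpow_sub two_pos, rpow_one]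
    have := (rpow_pos_of_pos ht γ).ne'
    have := (rpow_pos_of_pos two_pos γ).ne'
    field_simp
  rw [h2, h, show ((1 : ℝ) / 4) = 2 ^ (-2 : ℝ) by
    rw [rpow_neg two_pos.le, rpow_two]; norm_num, ← rpow_mul two_pos.le,
    show (-2 : ℝ) * -((1 - 2 * γ + 1) / 2) = (1 - 2 * γ) + 1 by ring, rpow_add_one two_ne_zero]
  ring

lemma Btwo_eq (n : ℕ) (γ : ℝ) :
    Btwo n γ = dTwo n γ ^ 2 * 2 ^ ((n : ℝ) - 5) *
      ∫ y, y ^ ((n : ℝ) / 2 - 2 - γ) * (besselInt γ y * besselInt γ y) ∂halfLine := by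
  have h := integral_rpow_mul_comp_mul_sq ((n : ℝ) - 3 - 2 * γ) (c := 1 / 4) (by norm_num)
    (fun y => besselInt γ y * besselInt γ y)
  rw [show ((n : ℝ) - 3 - 2 * γ - 1) / 2 = (n : ℝ) / 2 - 2 - γ by ring] at h
  have h2 : Btwo n γ = dTwo n γ ^ 2 * (1 / 4 * 2 ^ (2 * γ)) *
      ∫ t, t ^ ((n : ℝ) - 3 - 2 * γ) * (besselInt γ (t ^ 2 * (1 / 4)) *
        besselInt γ (t ^ 2 * (1 / 4))) ∂halfLine := by
    rw [Btwo, ← integral_const_mul]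
    refine integral_congr_ae ?_
    filter_upwards [ae_halfLine_pos] with t ht
    rw [whatOne, besselK_eq γ ht, div_rpow ht.le two_pos.le, rpow_neg ht.le, rpow_neg two_pos.le,
      show (n : ℝ) - 3 + 2 * γ = ((n : ℝ) - 3 - 2 * γ) + (γ + γ) + (γ + γ) by ring, rpow_add ht,
      rpow_add ht, rpow_add ht, two_mul, rpow_add two_pos]
    have := (rpow_pos_of_pos ht γ).ne'
    have := (rpow_pos_of_pos two_pos γ).ne'
    field_simp
    norm_num
  rw [h2, h, show ((1 : ℝ) / 4) = 2 ^ (-2 : ℝ) by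
    rw [rpow_neg two_pos.le, rpow_two]; norm_num, ← rpow_mul two_pos.le,
    show (1 : ℝ) / 2 = 2 ^ (-1 : ℝ) by rw [rpow_neg two_pos.le, rpow_one]; norm_num,
    show (n : ℝ) - 5 = -2 + 2 * γ + -1 + (-2 : ℝ) * -(((n : ℝ) - 3 - 2 * γ + 1) / 2) by ring,
    rpow_add two_pos, rpow_add two_pos, rpow_add two_pos]
  ring

/-! ### The extension as a superposition of Gaussians -/

/-- The product of two copies of Lebesgue measure on the half line. -/
abbrev quadrant : Measure (ℝ × ℝ) := halfLine.prod halfLine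

lemma ae_quadrant_pos : ∀ᵐ z ∂quadrant, 0 < z.1 ∧ 0 < z.2 := by
  filter_upwards [Measure.quasiMeasurePreserving_fst.ae ae_halfLine_pos,
    Measure.quasiMeasurePreserving_snd.ae ae_halfLine_pos] with z h1 h2 using ⟨h1, h2⟩

/-- The width of the convolution of the Gaussians of rates `z.1` and `z.2`. -/
def width (z : ℝ × ℝ) : ℝ := z.1⁻¹ + z.2⁻¹

lemma measurable_width : Measurable width := by
  unfold width
  fun_prop

lemma ae_width_pos : ∀ᵐ z ∂quadrant, 0 < width z :=
  ae_quadrant_pos.mono fun _ h => add_pos (inv_pos.2 h.1) (inv_pos.2 h.2)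

/-- The density of the mixture of Gaussians representing the extension. -/
def mixDensity (γ β c : ℝ) (z : ℝ × ℝ) : ℝ :=
  (z.1 ^ (-γ - 1) * rexp (-z.1)) * (z.2 ^ (β - 1) * rexp (-(c * z.2)))

lemma measurable_mixDensity (γ β c : ℝ) : Measurable (mixDensity γ β c) := by
  unfold mixDensity
  fun_prop

lemma integrable_mixDensity {γ β c j : ℝ} (hj0 : 0 < j) (hj : γ < j) (hβ : 0 < β) (hc : 0 < c) :
    Integrable (fun z => mixDensity γ β c z * width z ^ (-j)) quadrant := by
  refine ((integrable_rpow_mul_exp (sub_pos.2 hj) one_pos).mul_prod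
    (integrable_rpow_mul_exp hβ hc)).mono' ?_ ?_
  · have := measurable_mixDensity γ β c
    have := measurable_width
    fun_prop
  · filter_upwards [ae_quadrant_pos] with z ⟨h1, h2⟩
    have hw : z.1⁻¹ ≤ width z := le_add_of_nonneg_right (inv_pos.2 h2).le
    have hp := inv_pos.2 h1
    have : width z ^ (-j) ≤ z.1 ^ j := by
      refine (rpow_le_rpow_of_nonpos hp hw (neg_nonpos.2 hj0.le)).trans_eq ?_
      rw [inv_rpow h1.le, rpow_neg h1.le, inv_inv]
    have hwp : 0 < width z := hp.trans_le hw
    unfold mixDensity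
    rw [Real.norm_of_nonneg (by positivity), show j - γ - 1 = (-γ - 1) + j by ring, rpow_add h1,
      one_mul]
    calc _ ≤ z.1 ^ (-γ - 1) * rexp (-z.1) * (z.2 ^ (β - 1) * rexp (-(c * z.2))) * z.1 ^ j := by
          gcongr
      _ = _ := by ring

/-- The mixture of Gaussians, as a function of the squared distance `ρ` to the origin. -/
def gaussMix (γ β c j ρ : ℝ) : ℝ :=
  ∫ z, mixDensity γ β c z * width z ^ (-j) * rexp (-(ρ * (width z)⁻¹)) ∂quadrant

lemma integrable_gaussMix {γ β c j ρ : ℝ} (hj0 : 0 < j) (hj : γ < j) (hβ : 0 < β) (hc : 0 < c)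
    (hρ : 0 ≤ ρ) :
    Integrable (fun z => mixDensity γ β c z * width z ^ (-j) * rexp (-(ρ * (width z)⁻¹)))
      quadrant := by
  have := measurable_mixDensity γ β c
  have := measurable_width
  refine (integrable_mixDensity hj0 hj hβ hc).norm.mono' (by fun_prop) ?_
  filter_upwards [ae_width_pos] with z hz
  rw [norm_mul]
  refine mul_le_of_le_one_right (norm_nonneg _) ?_
  rw [Real.norm_of_nonneg (exp_pos _).le, Real.exp_le_one_iff]
  have := mul_nonneg hρ (inv_pos.2 hz).le
  linarith

lemma hasDerivAt_gaussMix_right {γ β c j ρ : ℝ} (hj0 : 0 < j) (hj : γ < j) (hβ : 0 < β)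
    (hc : 0 < c) (hρ : 0 < ρ) :
    HasDerivAt (gaussMix γ β c j) (-gaussMix γ β c (j + 1) ρ) ρ := by
  have hm := measurable_mixDensity γ β c
  have hw := measurable_width
  have h := (hasDerivAt_integral_of_dominated_loc_of_deriv_le (μ := quadrant)
    (F := fun ρ z => mixDensity γ β c z * width z ^ (-j) * rexp (-(ρ * (width z)⁻¹)))
    (F' := fun ρ z => mixDensity γ β c z * width z ^ (-j) *
      (rexp (-(ρ * (width z)⁻¹)) * -(width z)⁻¹))
    (bound := fun z => ‖mixDensity γ β c z * width z ^ (-(j + 1))‖)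
    (Ioi_mem_nhds hρ) (.of_forall fun ρ => by fun_prop)
    (integrable_gaussMix hj0 hj hβ hc hρ.le) (by fun_prop)
    (by
      filter_upwards [ae_width_pos] with z hz ρ hρ
      have hρ : 0 < ρ := hρ
      have hwi := inv_pos.2 hz
      rw [neg_add, ← sub_eq_add_neg, rpow_sub_one hz.ne', norm_mul, norm_mul, norm_mul, norm_neg,
        norm_mul, div_eq_mul_inv, norm_mul, ← mul_assoc, ← mul_assoc, Real.norm_of_nonneg (exp_pos _).le,
        mul_right_comm]
      refine mul_le_of_le_one_right (by positivity) ?_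
      rw [Real.exp_le_one_iff]
      have := mul_pos hρ hwi
      linarith)
    (integrable_mixDensity (by linarith) (by linarith) hβ hc).norm
    (.of_forall fun z ρ _ => by
      have := ((hasDerivAt_mul_const (x := ρ) (width z)⁻¹).neg.exp).const_mul
        (mixDensity γ β c z * width z ^ (-j))
      simpa using this)).2
  refine HasDerivAt.congr_deriv h ?_
  rw [gaussMix, ← integral_neg]
  refine integral_congr_ae ?_
  filter_upwards [ae_width_pos] with z hz
  rw [neg_add, ← sub_eq_add_neg, rpow_sub_one hz.ne']
  ring

lemma hasDerivAt_gaussMix_left {γ β c j ρ : ℝ} (hj0 : 0 < j) (hj : γ < j) (hβ : 0 < β)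
    (hc : 0 < c) (hρ : 0 ≤ ρ) :
    HasDerivAt (fun c => gaussMix γ β c j ρ) (-gaussMix γ (β + 1) c j ρ) c := by
  have hm := fun c β => measurable_mixDensity γ β c
  have hw := measurable_width
  have hfac : ∀ᵐ z ∂quadrant, ∀ c, mixDensity γ (β + 1) c z = mixDensity γ β c z * z.2 := by
    filter_upwards [ae_quadrant_pos] with z hz c
    unfold mixDensity
    rw [show β + 1 - 1 = β - 1 + 1 by ring, rpow_add_one hz.2.ne']
    ring
  have hc2 : 0 < c / 2 := by positivity
  have h := (hasDerivAt_integral_of_dominated_loc_of_deriv_le (μ := quadrant)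
    (F := fun c z => mixDensity γ β c z * width z ^ (-j) * rexp (-(ρ * (width z)⁻¹)))
    (F' := fun c z => -(mixDensity γ β c z * z.2 * width z ^ (-j) * rexp (-(ρ * (width z)⁻¹))))
    (bound := fun z => mixDensity γ (β + 1) (c / 2) z * width z ^ (-j) *
      rexp (-(ρ * (width z)⁻¹)))
    (Ioi_mem_nhds (half_lt_self hc)) (.of_forall fun c => by have := hm c β; fun_prop)
    (integrable_gaussMix hj0 hj hβ hc hρ) (by have := hm c β; fun_prop)
    (by
      filter_upwards [ae_width_pos, ae_quadrant_pos, hfac] with z hz hq hf x hx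
      have hx : c / 2 < x := hx
      have h1 := hq.1
      have h2 := hq.2
      rw [← hf, norm_neg]
      unfold mixDensity
      rw [Real.norm_of_nonneg (by positivity)]
      gcongr)
    (integrable_gaussMix hj0 hj (by linarith) hc2 hρ)
    (.of_forall fun z x _ => by
      unfold mixDensity
      have := (((((hasDerivAt_mul_const (x := x) z.2).neg.exp).const_mul (z.2 ^ (β - 1))).const_mul
        (z.1 ^ (-γ - 1) * rexp (-z.1))).mul_const (width z ^ (-j))).mul_const
        (rexp (-(ρ * (width z)⁻¹)))
      simp only [Pi.neg_apply] at this
      refine this.congr_deriv ?_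
      ring)).2
  refine HasDerivAt.congr_deriv h ?_
  rw [gaussMix, ← integral_neg]
  refine integral_congr_ae ?_
  filter_upwards [hfac] with z hz
  rw [hz]

lemma integral_gaussian_conv {n : ℕ} {s r : ℝ} (hs : 0 < s) (hr : 0 < r)
    (x : EuclideanSpace ℝ (Fin n)) :
    ∫ ξ : EuclideanSpace ℝ (Fin n), rexp (-(s * ‖ξ‖ ^ 2)) * rexp (-(r * ‖x - ξ‖ ^ 2)) =
      (π / (s + r)) ^ ((n : ℝ) / 2) * rexp (-(‖x‖ ^ 2 * (s⁻¹ + r⁻¹)⁻¹)) := by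
  have hsr : 0 < s + r := add_pos hs hr
  have key : ∀ ξ : EuclideanSpace ℝ (Fin n),
      rexp (-(s * ‖ξ‖ ^ 2)) * rexp (-(r * ‖x - ξ‖ ^ 2)) =
      rexp (-(s + r) * ‖ξ - (r / (s + r)) • x‖ ^ 2) * rexp (-(‖x‖ ^ 2 * (s⁻¹ + r⁻¹)⁻¹)) := by
    intro ξ
    rw [← Real.exp_add, ← Real.exp_add, norm_sub_sq_real, norm_sub_sq_real, inner_smul_right,
      norm_smul, real_inner_comm, mul_pow, Real.norm_eq_abs, sq_abs]
    congr 1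
    field_simp
    ring
  simp only [key]
  rw [integral_mul_const, integral_sub_right_eq_self
    (fun ξ : EuclideanSpace ℝ (Fin n) => rexp (-(s + r) * ‖ξ‖ ^ 2)),
    GaussianFourier.integral_rexp_neg_mul_sq_norm hsr, finrank_euclideanSpace_fin]

/-- The constant in front of the mixture of Gaussians representing the extension. -/
def extConst (n : ℕ) (γ : ℝ) : ℝ :=
  png n γ * cng n γ * π ^ ((n : ℝ) / 2) /
    (Real.Gamma ((n : ℝ) / 2 - γ) * Real.Gamma ((n : ℝ) / 2 + γ))

lemma bubbleExt_eq {n : ℕ} {γ : ℝ} (hγ : 0 < γ) (hn : 2 * γ < n) (x : EuclideanSpace ℝ (Fin n))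
    {t : ℝ} (ht : 0 < t) :
    bubbleExt n γ 1 0 x t =
      extConst n γ * t ^ (2 * γ) * gaussMix γ γ (t ^ 2) ((n : ℝ) / 2) (‖x‖ ^ 2) := by
  set a := (n : ℝ) / 2 - γ with ha
  set b := (n : ℝ) / 2 + γ with hb
  have ha0 : 0 < a := by rw [ha]; linarith
  have hb0 : 0 < b := by rw [hb]; linarith
  have hGa := Gamma_pos_of_pos ha0
  have hGb := Gamma_pos_of_pos hb0
  set f : EuclideanSpace ℝ (Fin n) → ℝ × ℝ → ℝ := fun ξ z =>
    (z.1 ^ (a - 1) * rexp (-((1 + ‖ξ‖ ^ 2) * z.1))) *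
      (z.2 ^ (b - 1) * rexp (-((‖x - ξ‖ ^ 2 + t ^ 2) * z.2))) with hf
  have hfe : ∀ ξ z, f ξ z = z.1 ^ (a - 1) * z.2 ^ (b - 1) * rexp (-z.1) * rexp (-(t ^ 2 * z.2)) *
      (rexp (-(z.1 * ‖ξ‖ ^ 2)) * rexp (-(z.2 * ‖x - ξ‖ ^ 2))) := by
    intro ξ z
    simp only [hf]
    rw [show -((1 + ‖ξ‖ ^ 2) * z.1) = -z.1 + -(z.1 * ‖ξ‖ ^ 2) by ring,
      show -((‖x - ξ‖ ^ 2 + t ^ 2) * z.2) = -(t ^ 2 * z.2) + -(z.2 * ‖x - ξ‖ ^ 2) by ring,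
      Real.exp_add, Real.exp_add]
    ring
  have hpt : ∀ ξ : EuclideanSpace ℝ (Fin n), 0 < ‖x - ξ‖ ^ 2 + t ^ 2 := fun ξ => by positivity
  have h1t : ∀ ξ : EuclideanSpace ℝ (Fin n), 0 < 1 + ‖ξ‖ ^ 2 := fun ξ => by positivity
  have hlhs : ∀ ξ : EuclideanSpace ℝ (Fin n), ∫ z, f ξ z ∂quadrant =
      Real.Gamma a * (1 + ‖ξ‖ ^ 2) ^ (-a) * (Real.Gamma b * (‖x - ξ‖ ^ 2 + t ^ 2) ^ (-b)) := by
    intro ξ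
    rw [← integral_rpow_mul_exp ha0 (h1t ξ), ← integral_rpow_mul_exp hb0 (hpt ξ)]
    exact integral_prod_mul (fun s => s ^ (a - 1) * rexp (-((1 + ‖ξ‖ ^ 2) * s)))
      (fun s => s ^ (b - 1) * rexp (-((‖x - ξ‖ ^ 2 + t ^ 2) * s)))
  have hrhs : ∀ᵐ z ∂quadrant, ∫ ξ, f ξ z = π ^ ((n : ℝ) / 2) *
      (mixDensity γ γ (t ^ 2) z * width z ^ (-((n : ℝ) / 2)) *
        rexp (-(‖x‖ ^ 2 * (width z)⁻¹))) := by
    filter_upwards [ae_quadrant_pos, ae_width_pos] with z ⟨h1, h2⟩ hw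
    simp only [hfe]
    rw [integral_const_mul, integral_gaussian_conv h1 h2,
      show z.1 + z.2 = z.1 * z.2 * width z by unfold width; field_simp; ring,
      div_rpow pi_pos.le (by positivity), mul_rpow (by positivity) hw.le, mul_rpow h1.le h2.le,
      rpow_neg hw.le, show a - 1 = (-γ - 1) + (n : ℝ) / 2 by rw [ha]; ring,
      show b - 1 = (γ - 1) + (n : ℝ) / 2 by rw [hb]; ring, rpow_add h1, rpow_add h2]
    unfold mixDensity
    rw [show (z.1⁻¹ + z.2⁻¹) = width z from rfl]
    have := (rpow_pos_of_pos h1 ((n : ℝ) / 2)).ne'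
    have := (rpow_pos_of_pos h2 ((n : ℝ) / 2)).ne'
    field_simp
  have hswap := integral_integral_swap_of_nonneg (μ := volume) (ν := quadrant) (f := f)
    (by
      apply Measurable.aestronglyMeasurable
      simp only [hf, Function.uncurry_def]
      fun_prop)
    (.of_forall fun ξ => by
      filter_upwards [ae_quadrant_pos] with z ⟨h1, h2⟩
      simp only [hf]
      positivity)
    (by
      filter_upwards [ae_quadrant_pos] with z ⟨h1, h2⟩
      refine .of_forall fun ξ => ?_
      simp only [hf]
      positivity)
    (.of_forall fun ξ => (integrable_rpow_mul_exp ha0 (h1t ξ)).mul_prod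
      (integrable_rpow_mul_exp hb0 (hpt ξ)))
    (by
      filter_upwards [ae_quadrant_pos] with z ⟨h1, h2⟩
      simp only [hfe]
      refine Integrable.const_mul (not_imp_comm.1 integral_undef ?_) _
      rw [integral_gaussian_conv h1 h2]
      positivity)
  rw [integral_congr_ae hrhs, integral_const_mul] at hswap
  have hint : ∀ ξ : EuclideanSpace ℝ (Fin n),
      t ^ (2 * γ) / (‖x - ξ‖ ^ 2 + t ^ 2) ^ (((n : ℝ) + 2 * γ) / 2) * bubble n γ 1 0 ξ =
        t ^ (2 * γ) * cng n γ / (Real.Gamma a * Real.Gamma b) * ∫ z, f ξ z ∂quadrant := by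
    intro ξ
    rw [hlhs, bubble, sub_zero, one_pow, one_div, inv_rpow (h1t ξ).le, rpow_neg (h1t ξ).le,
      rpow_neg (hpt ξ).le, show ((n : ℝ) + 2 * γ) / 2 = b by rw [hb]; ring,
      show ((n : ℝ) - 2 * γ) / 2 = a by rw [ha]; ring]
    field_simp
  rw [bubbleExt, integral_congr_ae (.of_forall hint), integral_const_mul, hswap, extConst, gaussMix]
  ring

/-! ### The integrals over horizontal slices -/

lemma integral_comp_norm_sq {n : ℕ} (hn : 0 < n) (g : ℝ → ℝ) :
    ∫ x : EuclideanSpace ℝ (Fin n), g (‖x‖ ^ 2) =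
      sphereConst n / 2 * ∫ ρ, ρ ^ ((n : ℝ) / 2 - 1) * g ρ ∂halfLine := by
  have : Nonempty (Fin n) := ⟨⟨0, hn⟩⟩
  have hn' : (0 : ℝ) < n := Nat.cast_pos.2 hn
  have hG := Gamma_pos_of_pos (half_pos hn')
  have h1 := integral_fun_norm_addHaar (volume : Measure (EuclideanSpace ℝ (Fin n)))
    (fun r => g (r ^ 2))
  have h2 := integral_rpow_mul_comp_mul_sq ((n : ℝ) - 1) one_pos g
  have h3 : ∫ y in Set.Ioi (0 : ℝ), y ^ (n - 1) • g (y ^ 2) =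
      ∫ t, t ^ ((n : ℝ) - 1) * g (t ^ 2 * 1) ∂halfLine := by
    congr 1 with y
    rw [mul_one, smul_eq_mul, ← rpow_natCast, Nat.cast_pred hn]
  have hvol : volume.real (Metric.ball (0 : EuclideanSpace ℝ (Fin n)) 1) =
      π ^ ((n : ℝ) / 2) / Real.Gamma ((n : ℝ) / 2 + 1) := by
    rw [measureReal_def, EuclideanSpace.volume_ball, ENNReal.ofReal_one, one_pow, one_mul,
      ENNReal.toReal_ofReal (by positivity), Fintype.card_fin, sqrt_eq_rpow, ← rpow_natCast,
      ← rpow_mul pi_pos.le]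
    ring_nf
  rw [finrank_euclideanSpace_fin, h3, h2, hvol, Gamma_add_one (by positivity), one_rpow,
    show ((n : ℝ) - 1 - 1) / 2 = (n : ℝ) / 2 - 1 by ring, nsmul_eq_mul, smul_eq_mul] at h1
  rw [h1, sphereConst]
  field_simp

lemma norm_fderiv_bubbleExt {n : ℕ} {γ : ℝ} (hγ : 0 < γ) (hn : 2 * γ < n)
    {x : EuclideanSpace ℝ (Fin n)} (hx : x ≠ 0) {t : ℝ} (ht : 0 < t) :
    ‖fderiv ℝ (fun y => bubbleExt n γ 1 0 y t) x‖ ^ 2 =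
      4 * (extConst n γ * t ^ (2 * γ)) ^ 2 *
        (‖x‖ ^ 2 * gaussMix γ γ (t ^ 2) ((n : ℝ) / 2 + 1) (‖x‖ ^ 2) ^ 2) := by
  have hx' : 0 < ‖x‖ ^ 2 := by positivity
  have h1 := hasDerivAt_gaussMix_right (γ := γ) (β := γ) (c := t ^ 2) (j := (n : ℝ) / 2)
    (by linarith) (by linarith) hγ (by positivity) hx'
  have h2 := (h1.comp_hasFDerivAt x (hasStrictFDerivAt_norm_sq x).hasFDerivAt).const_mul
    (extConst n γ * t ^ (2 * γ))
  have h3 : (fun y => bubbleExt n γ 1 0 y t) = fun y => extConst n γ * t ^ (2 * γ) *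
      (gaussMix γ γ (t ^ 2) ((n : ℝ) / 2) ∘ fun y => ‖y‖ ^ 2) y :=
    funext fun y => bubbleExt_eq hγ hn y ht
  rw [h3, h2.fderiv]
  rw [← Nat.cast_smul_eq_nsmul ℝ]
  simp only [norm_smul, norm_neg, mul_pow, Real.norm_eq_abs, sq_abs, innerSL_apply_norm]
  push_cast
  ring

lemma deriv_bubbleExt {n : ℕ} {γ : ℝ} (hγ : 0 < γ) (hn : 2 * γ < n)
    (x : EuclideanSpace ℝ (Fin n)) {t : ℝ} (ht : 0 < t) :
    deriv (fun t => bubbleExt n γ 1 0 x t) t =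
      2 * extConst n γ * t ^ (2 * γ - 1) * ∫ z, (γ * mixDensity γ γ (t ^ 2) z -
        t ^ 2 * mixDensity γ (γ + 1) (t ^ 2) z) * width z ^ (-((n : ℝ) / 2)) *
          rexp (-(‖x‖ ^ 2 * (width z)⁻¹)) ∂quadrant := by
  have ht2 : 0 < t ^ 2 := by positivity
  have hj0 : 0 < (n : ℝ) / 2 := by linarith
  have hj : γ < (n : ℝ) / 2 := by linarith
  have h1 := hasDerivAt_gaussMix_left (γ := γ) (β := γ) (c := t ^ 2) (j := (n : ℝ) / 2)
    hj0 hj hγ ht2 (sq_nonneg ‖x‖)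
  have h2 := ((Real.hasDerivAt_rpow_const (p := 2 * γ) (Or.inl ht.ne')).const_mul
    (extConst n γ)).mul (HasDerivAt.comp
    (h₂ := fun c => gaussMix γ γ c ((n : ℝ) / 2) (‖x‖ ^ 2)) (h := fun t => t ^ 2) t h1
    (hasDerivAt_pow 2 t))
  have h3 : (fun t => bubbleExt n γ 1 0 x t) =ᶠ[𝓝 t] fun t => extConst n γ * t ^ (2 * γ) *
      gaussMix γ γ (t ^ 2) ((n : ℝ) / 2) (‖x‖ ^ 2) := by
    filter_upwards [Ioi_mem_nhds ht] with s hs using bubbleExt_eq hγ hn x hs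
  have h4 : ∫ z, (γ * mixDensity γ γ (t ^ 2) z -
        t ^ 2 * mixDensity γ (γ + 1) (t ^ 2) z) * width z ^ (-((n : ℝ) / 2)) *
          rexp (-(‖x‖ ^ 2 * (width z)⁻¹)) ∂quadrant =
      γ * gaussMix γ γ (t ^ 2) ((n : ℝ) / 2) (‖x‖ ^ 2) -
        t ^ 2 * gaussMix γ (γ + 1) (t ^ 2) ((n : ℝ) / 2) (‖x‖ ^ 2) := by
    rw [gaussMix, gaussMix, ← integral_const_mul, ← integral_const_mul, ← integral_sub
      ((integrable_gaussMix hj0 hj hγ ht2 (sq_nonneg _)).const_mul _)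
      ((integrable_gaussMix hj0 hj (by linarith) ht2 (sq_nonneg _)).const_mul _)]
    congr 1 with z
    ring
  rw [h3.deriv_eq, h4]
  refine (HasDerivAt.deriv h2).trans ?_
  rw [Function.comp_apply, rpow_sub_one ht.ne']
  field_simp
  ring

lemma integral_slice_fderiv {n : ℕ} {γ : ℝ} (hγ : 0 < γ) (hn : 4 * γ < n) {t : ℝ} (ht : 0 < t) :
    ∫ x : EuclideanSpace ℝ (Fin n), t ^ (3 - 2 * γ) * ‖x‖ ^ 2 *
      ‖fderiv ℝ (fun y => bubbleExt n γ 1 0 y t) x‖ ^ 2 =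
    2 * extConst n γ ^ 2 * sphereConst n * t ^ (3 + 2 * γ) *
      ∫ l, l ^ ((n : ℝ) / 2 + 1) * (∫ z, mixDensity γ γ (t ^ 2) z * width z *
        rexp (-(l * width z)) ∂quadrant) ^ 2 ∂halfLine := by
  have hn0 : 0 < n := by
    have : (0 : ℝ) < n := by linarith
    exact_mod_cast this
  have : Nonempty (Fin n) := ⟨⟨0, hn0⟩⟩
  have hm := measurable_mixDensity γ γ (t ^ 2)
  have hw := measurable_width
  have h1 : ∀ᵐ x : EuclideanSpace ℝ (Fin n), t ^ (3 - 2 * γ) * ‖x‖ ^ 2 *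
      ‖fderiv ℝ (fun y => bubbleExt n γ 1 0 y t) x‖ ^ 2 =
      4 * extConst n γ ^ 2 * t ^ (3 + 2 * γ) * (fun ρ =>
        ρ ^ 2 * gaussMix γ γ (t ^ 2) ((n : ℝ) / 2 + 1) ρ ^ 2) (‖x‖ ^ 2) := by
    filter_upwards [compl_mem_ae_iff.2 (measure_singleton (0 : EuclideanSpace ℝ (Fin n)))] with x hx
    rw [norm_fderiv_bubbleExt hγ (by linarith) hx ht, show 3 + 2 * γ = 3 - 2 * γ + 2 * γ + 2 * γ by ring,
      rpow_add ht, rpow_add ht]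
    ring
  rw [integral_congr_ae h1, integral_const_mul, integral_comp_norm_sq hn0
    (fun ρ => ρ ^ 2 * gaussMix γ γ (t ^ 2) ((n : ℝ) / 2 + 1) ρ ^ 2)]
  have hbase : Integrable (fun z => (mixDensity γ γ (t ^ 2) z * width z ^ (-((n : ℝ) / 2 + 1))) *
      width z ^ (((n : ℝ) / 2 + 2) / 2)) quadrant := by
    refine (integrable_mixDensity (γ := γ) (β := γ) (c := t ^ 2) (j := (n : ℝ) / 4)
      (by linarith) (by linarith) hγ (by positivity)).congr ?_
    filter_upwards [ae_width_pos] with z hz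
    rw [mul_assoc, ← rpow_add hz]
    ring_nf
  have h2 := mellin_sq_laplace_inv (q := (n : ℝ) / 2 + 2) (by linarith) (by fun_prop) hw
    ae_width_pos hbase
  have h3 : ∀ l : ℝ, ∫ z, mixDensity γ γ (t ^ 2) z * width z ^ (-((n : ℝ) / 2 + 1)) *
      width z ^ ((n : ℝ) / 2 + 2) * rexp (-(l * width z)) ∂quadrant =
      ∫ z, mixDensity γ γ (t ^ 2) z * width z * rexp (-(l * width z)) ∂quadrant := by
    intro l
    refine integral_congr_ae ?_
    filter_upwards [ae_width_pos] with z hz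
    rw [mul_assoc (mixDensity _ _ _ _), ← rpow_add hz,
      show -((n : ℝ) / 2 + 1) + ((n : ℝ) / 2 + 2) = 1 by ring, rpow_one]
  simp only [h3] at h2
  rw [show (n : ℝ) / 2 + 2 - 1 = (n : ℝ) / 2 + 1 by ring] at h2
  rw [← h2, integral_congr_ae (g := fun r => r ^ ((n : ℝ) / 2 + 1) *
    gaussMix γ γ (t ^ 2) ((n : ℝ) / 2 + 1) r ^ 2)]
  · simp only [gaussMix]
    ring
  · filter_upwards [ae_halfLine_pos] with r hr
    rw [show (n : ℝ) / 2 + 1 = (n : ℝ) / 2 - 1 + 2 by ring, rpow_add hr, rpow_two]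
    ring

lemma integral_slice_deriv {n : ℕ} {γ : ℝ} (hγ : 0 < γ) (hn : 4 * γ + 2 < n) {t : ℝ}
    (ht : 0 < t) :
    ∫ x : EuclideanSpace ℝ (Fin n), t ^ (3 - 2 * γ) * ‖x‖ ^ 2 *
      deriv (fun t => bubbleExt n γ 1 0 x t) t ^ 2 =
    2 * extConst n γ ^ 2 * sphereConst n * t ^ (1 + 2 * γ) *
      ∫ l, l ^ ((n : ℝ) / 2) * (∫ z, (γ * mixDensity γ γ (t ^ 2) z -
        t ^ 2 * mixDensity γ (γ + 1) (t ^ 2) z) * width z *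
          rexp (-(l * width z)) ∂quadrant) ^ 2 ∂halfLine := by
  have hn0 : 0 < n := by
    have : (0 : ℝ) < n := by linarith
    exact_mod_cast this
  have ht2 : 0 < t ^ 2 := by positivity
  have hm := fun β => measurable_mixDensity γ β (t ^ 2)
  have hw := measurable_width
  set h : ℝ × ℝ → ℝ := fun z => γ * mixDensity γ γ (t ^ 2) z -
    t ^ 2 * mixDensity γ (γ + 1) (t ^ 2) z with hh
  have hhm : Measurable h := by
    have := hm γ
    have := hm (γ + 1)
    fun_prop
  have h1 : ∀ x : EuclideanSpace ℝ (Fin n), t ^ (3 - 2 * γ) * ‖x‖ ^ 2 *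
      deriv (fun t => bubbleExt n γ 1 0 x t) t ^ 2 =
      4 * extConst n γ ^ 2 * t ^ (1 + 2 * γ) * (fun ρ => ρ * (∫ z, h z *
        width z ^ (-((n : ℝ) / 2)) * rexp (-(ρ * (width z)⁻¹)) ∂quadrant) ^ 2) (‖x‖ ^ 2) := by
    intro x
    rw [deriv_bubbleExt hγ (by linarith) x ht,
      show 1 + 2 * γ = 3 - 2 * γ + (2 * γ - 1) + (2 * γ - 1) by ring, rpow_add ht, rpow_add ht]
    ring
  rw [integral_congr_ae (.of_forall h1), integral_const_mul, integral_comp_norm_sq hn0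
    (fun ρ => ρ * (∫ z, h z * width z ^ (-((n : ℝ) / 2)) *
      rexp (-(ρ * (width z)⁻¹)) ∂quadrant) ^ 2)]
  have hbase : Integrable (fun z => (h z * width z ^ (-((n : ℝ) / 2))) *
      width z ^ (((n : ℝ) / 2 + 1) / 2)) quadrant := by
    have i1 := integrable_mixDensity (γ := γ) (β := γ) (c := t ^ 2) (j := ((n : ℝ) / 2 - 1) / 2)
      (by linarith) (by linarith) hγ ht2
    have i2 := integrable_mixDensity (γ := γ) (β := γ + 1) (c := t ^ 2)
      (j := ((n : ℝ) / 2 - 1) / 2) (by linarith) (by linarith) (by linarith) ht2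
    refine ((i1.const_mul γ).sub (i2.const_mul (t ^ 2))).congr ?_
    filter_upwards [ae_width_pos] with z hz
    rw [mul_assoc (h z), ← rpow_add hz]
    simp only [hh, Pi.sub_apply]
    ring_nf
  have h2 := mellin_sq_laplace_inv (q := (n : ℝ) / 2 + 1) (by linarith) (by fun_prop) hw
    ae_width_pos hbase
  have h3 : ∀ l : ℝ, ∫ z, h z * width z ^ (-((n : ℝ) / 2)) *
      width z ^ ((n : ℝ) / 2 + 1) * rexp (-(l * width z)) ∂quadrant =
      ∫ z, h z * width z * rexp (-(l * width z)) ∂quadrant := by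
    intro l
    refine integral_congr_ae ?_
    filter_upwards [ae_width_pos] with z hz
    rw [mul_assoc (h z), ← rpow_add hz,
      show -((n : ℝ) / 2) + ((n : ℝ) / 2 + 1) = 1 by ring, rpow_one]
  simp only [h3, add_sub_cancel_right] at h2
  rw [← h2, integral_congr_ae (g := fun r => r ^ ((n : ℝ) / 2) * (∫ z, h z *
        width z ^ (-((n : ℝ) / 2)) * rexp (-(r * (width z)⁻¹)) ∂quadrant) ^ 2)]
  · ring
  · filter_upwards [ae_halfLine_pos] with r hr
    rw [rpow_sub_one hr.ne']
    field_simp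

lemma integrable_mixDensity_mul_width {γ β c l : ℝ} (hc : 0 < c) (hl : 0 < l) :
    Integrable (fun z => mixDensity γ β c z * width z * rexp (-(l * width z))) quadrant ∧
    ∫ z, mixDensity γ β c z * width z * rexp (-(l * width z)) ∂quadrant =
      besselInt (-γ - 1) l * (c ^ (-β) * besselInt β (c * l)) +
        besselInt (-γ) l * (c ^ (1 - β) * besselInt (β - 1) (c * l)) := by
  set k : ℝ → ℝ → ℝ → ℝ := fun c a s =>
    s ^ (a - 1) * rexp (-(c * s)) * rexp (-(l * s⁻¹)) with hk
  have hki : ∀ c > 0, ∀ a, Integrable (k c a) halfLine :=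
    fun c hc a => integrable_besselKernel a hc hl
  have hkv : ∀ c > 0, ∀ a, ∫ s, k c a s ∂halfLine = c ^ (-a) * besselInt a (c * l) :=
    fun c hc a => integral_besselKernel a hc l
  have heq : (fun z => mixDensity γ β c z * width z * rexp (-(l * width z))) =ᵐ[quadrant]
      (fun z => k 1 (-γ - 1) z.1 * k c β z.2) + fun z => k 1 (-γ) z.1 * k c (β - 1) z.2 := by
    filter_upwards [ae_quadrant_pos] with z ⟨h1, h2⟩
    simp only [hk, Pi.add_apply]
    unfold mixDensity width
    rw [rpow_sub_one h1.ne' (-γ - 1), rpow_sub_one h2.ne' (β - 1), 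
      show -(l * (z.1⁻¹ + z.2⁻¹)) = -(l * z.1⁻¹) + -(l * z.2⁻¹) by ring, Real.exp_add, one_mul]
    ring
  have i1 := (hki 1 one_pos (-γ - 1)).mul_prod (hki c hc β)
  have i2 := (hki 1 one_pos (-γ)).mul_prod (hki c hc (β - 1))
  refine ⟨(i1.add i2).congr heq.symm, ?_⟩
  rw [integral_congr_ae heq, integral_add' i1 i2, integral_prod_mul, integral_prod_mul,
    hkv 1 one_pos, hkv 1 one_pos, hkv c hc, hkv c hc, one_rpow, one_rpow, one_mul, one_mul, one_mul,
    neg_sub]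


/-! ### Mellin transforms of the profiles -/

/-- The Mellin transform of `f` converges absolutely at `s`, with value `v`. -/
def HasRealMellin (f : ℝ → ℝ) (s v : ℝ) : Prop :=
  Integrable (fun l => l ^ (s - 1) * f l) halfLine ∧ ∫ l, l ^ (s - 1) * f l ∂halfLine = v

/-- The Mellin transform of a multiplicative convolution, with quadratic scaling. -/
lemma integrable_mul_comp_sq_mul {f g : ℝ → ℝ} {q r v w : ℝ} (hfm : Measurable f)
    (hgm : Measurable g) (hf : HasRealMellin f r v) (hg : HasRealMellin g q w) :
    Integrable (fun z : ℝ × ℝ =>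
      z.1 ^ (2 * q - 1) * (z.2 ^ (r + q - 1) * (f z.2 * g (z.1 ^ 2 * z.2)))) quadrant ∧
    ∫ z : ℝ × ℝ, z.1 ^ (2 * q - 1) * (z.2 ^ (r + q - 1) * (f z.2 * g (z.1 ^ 2 * z.2))) ∂quadrant =
      1 / 2 * (v * w) := by
  have hq : ((2 * q - 1) - 1) / 2 = q - 1 := by ring
  have hq' : ((2 * q - 1) + 1) / 2 = q := by ring
  have hexp : ∀ l : ℝ, 0 < l → l ^ (r + q - 1) * l ^ (-q) = l ^ (r - 1) := fun l hl => by
    rw [← rpow_add hl]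
    ring_nf
  have hgi := hg.1
  rw [← hq] at hgi
  have hint : Integrable (fun z : ℝ × ℝ =>
      z.1 ^ (2 * q - 1) * (z.2 ^ (r + q - 1) * (f z.2 * g (z.1 ^ 2 * z.2)))) quadrant := by
    rw [integrable_prod_iff' (by apply Measurable.aestronglyMeasurable; fun_prop)]
    constructor
    · filter_upwards [ae_halfLine_pos] with l hl
      refine ((integrable_rpow_mul_comp_mul_sq (2 * q - 1) hl hgi).const_mul
        (l ^ (r + q - 1) * f l)).congr (.of_forall fun t => ?_)
      ring
    · refine (hf.1.norm.mul_const (1 / 2 * ∫ y, y ^ (q - 1) * ‖g y‖ ∂halfLine)).congr ?_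
      filter_upwards [ae_halfLine_pos] with l hl
      have h := integral_rpow_mul_comp_mul_sq (2 * q - 1) hl fun y => ‖g y‖
      rw [hq, hq'] at h
      refine ((integral_congr_ae (g := fun t => l ^ (r + q - 1) * ‖f l‖ *
        (t ^ (2 * q - 1) * ‖g (t ^ 2 * l)‖)) ?_).trans ?_).symm
      · filter_upwards [ae_halfLine_pos] with t ht
        rw [norm_mul, norm_mul, norm_mul, Real.norm_of_nonneg (rpow_nonneg hl.le _),
          Real.norm_of_nonneg (rpow_nonneg ht.le _)]
        ring
      · rw [integral_const_mul, h, norm_mul, Real.norm_of_nonneg (rpow_nonneg hl.le _),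
          ← hexp l hl]
        ring
  refine ⟨hint, ?_⟩
  rw [integral_prod_symm _ hint, ← hf.2, ← integral_mul_const, ← integral_const_mul]
  refine integral_congr_ae ?_
  filter_upwards [ae_halfLine_pos] with l hl
  have h := integral_rpow_mul_comp_mul_sq (2 * q - 1) hl g
  rw [hq, hq', hg.2] at h
  rw [integral_congr_ae (g := fun t => l ^ (r + q - 1) * f l *
    (t ^ (2 * q - 1) * g (t ^ 2 * l))) (.of_forall fun t => by ring), integral_const_mul, h,
    ← hexp l hl]
  ring

lemma integral_integral_sq_add {f₁ f₂ g₁ g₂ : ℝ → ℝ} {q r v₁ v₂ v₃ w₁ w₂ w₃ : ℝ}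
    (hf₁ : Measurable f₁) (hf₂ : Measurable f₂) (hg₁ : Measurable g₁) (hg₂ : Measurable g₂)
    (hv₁ : HasRealMellin (fun l => f₁ l * f₁ l) r v₁)
    (hv₂ : HasRealMellin (fun l => f₁ l * f₂ l) (r - 1) v₂)
    (hv₃ : HasRealMellin (fun l => f₂ l * f₂ l) (r - 2) v₃)
    (hw₁ : HasRealMellin (fun y => g₁ y * g₁ y) q w₁)
    (hw₂ : HasRealMellin (fun y => g₁ y * g₂ y) (q + 1) w₂)
    (hw₃ : HasRealMellin (fun y => g₂ y * g₂ y) (q + 2) w₃) :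
    ∫ t, t ^ (2 * q - 1) * ∫ l, l ^ (r + q - 1) *
      (f₁ l * g₁ (t ^ 2 * l) + t ^ 2 * (f₂ l * g₂ (t ^ 2 * l))) ^ 2 ∂halfLine ∂halfLine =
      1 / 2 * (v₁ * w₁ + 2 * (v₂ * w₂) + v₃ * w₃) := by
  set G : ℝ → ℝ → (ℝ → ℝ) → (ℝ → ℝ) → ℝ × ℝ → ℝ := fun q r f g z =>
    z.1 ^ (2 * q - 1) * (z.2 ^ (r + q - 1) * (f z.2 * g (z.1 ^ 2 * z.2))) with hG
  obtain ⟨i₁, e₁⟩ : Integrable (G q r (fun l => f₁ l * f₁ l) fun y => g₁ y * g₁ y) quadrant ∧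
      ∫ z, G q r (fun l => f₁ l * f₁ l) (fun y => g₁ y * g₁ y) z ∂quadrant = _ :=
    integrable_mul_comp_sq_mul (by fun_prop) (by fun_prop) hv₁ hw₁
  obtain ⟨i₂, e₂⟩ : Integrable (G (q + 1) (r - 1) (fun l => f₁ l * f₂ l) fun y => g₁ y * g₂ y)
      quadrant ∧ ∫ z, G (q + 1) (r - 1) (fun l => f₁ l * f₂ l) (fun y => g₁ y * g₂ y) z ∂quadrant =
        _ := integrable_mul_comp_sq_mul (by fun_prop) (by fun_prop) hv₂ hw₂
  obtain ⟨i₃, e₃⟩ : Integrable (G (q + 2) (r - 2) (fun l => f₂ l * f₂ l) fun y => g₂ y * g₂ y)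
      quadrant ∧ ∫ z, G (q + 2) (r - 2) (fun l => f₂ l * f₂ l) (fun y => g₂ y * g₂ y) z ∂quadrant =
        _ := integrable_mul_comp_sq_mul (by fun_prop) (by fun_prop) hv₃ hw₃
  have heq : (G q r (fun l => f₁ l * f₁ l) fun y => g₁ y * g₁ y) +
      (fun z => 2 * G (q + 1) (r - 1) (fun l => f₁ l * f₂ l) (fun y => g₁ y * g₂ y) z) +
      G (q + 2) (r - 2) (fun l => f₂ l * f₂ l) (fun y => g₂ y * g₂ y) =ᵐ[quadrant]
      fun z => z.1 ^ (2 * q - 1) * (z.2 ^ (r + q - 1) *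
        (f₁ z.2 * g₁ (z.1 ^ 2 * z.2) + z.1 ^ 2 * (f₂ z.2 * g₂ (z.1 ^ 2 * z.2))) ^ 2) := by
    filter_upwards [ae_quadrant_pos] with z hz
    simp only [hG, Pi.add_apply]
    rw [show 2 * (q + 1) - 1 = 2 * q - 1 + (2 : ℕ) by push_cast; ring,
      show 2 * (q + 2) - 1 = 2 * q - 1 + (4 : ℕ) by push_cast; ring,
      show r - 1 + (q + 1) - 1 = r + q - 1 by ring, show r - 2 + (q + 2) - 1 = r + q - 1 by ring,
      rpow_add_natCast hz.1.ne', rpow_add_natCast hz.1.ne']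
    ring
  have hint := ((i₁.add (i₂.const_mul 2)).add i₃).congr heq
  simp_rw [← integral_const_mul]
  rw [← integral_prod (μ := halfLine) (ν := halfLine) _ hint, ← integral_congr_ae heq,
    integral_add' (i₁.add (i₂.const_mul 2)) i₃, integral_add' i₁ (i₂.const_mul 2),
    integral_const_mul, e₁, e₂, e₃]
  ring

/-- The Mellin transform of a product of two Bessel functions, in terms of `HasRealMellin`. -/
lemma hasRealMellin_besselInt_mul {q a b : ℝ} (hq : 0 < q) (ha : 0 < a + q) (hb : 0 < b + q)
    (hab : 0 < a + b + q) {v : ℝ} (hv : Real.Gamma q * Real.Gamma (a + q) * Real.Gamma (b + q) *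
      Real.Gamma (a + b + q) / Real.Gamma (a + b + 2 * q) = v) :
    HasRealMellin (fun l => besselInt a l * besselInt b l) q v :=
  hv ▸ mellin_besselInt_mul_besselInt hq ha hb hab

lemma HasRealMellin.mul_sub_mul_mul_sub {A B C D : ℝ → ℝ} {s a c v₁ v₂ v₃ v₄ : ℝ}
    (h₁ : HasRealMellin (fun y => A y * C y) s v₁) (h₂ : HasRealMellin (fun y => A y * D y) s v₂)
    (h₃ : HasRealMellin (fun y => B y * C y) s v₃) (h₄ : HasRealMellin (fun y => B y * D y) s v₄) :
    HasRealMellin (fun y => (a * A y - B y) * (c * C y - D y)) s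
      (a * c * v₁ - a * v₂ - c * v₃ + v₄) := by
  have i := (((h₁.1.const_mul (a * c)).sub (h₂.1.const_mul a)).sub (h₃.1.const_mul c)).add h₄.1
  have heq : ∀ y, ((((fun y => a * c * (y ^ (s - 1) * (A y * C y))) -
      fun y => a * (y ^ (s - 1) * (A y * D y))) - fun y => c * (y ^ (s - 1) * (B y * C y))) +
      fun y => y ^ (s - 1) * (B y * D y)) y =
      y ^ (s - 1) * ((a * A y - B y) * (c * C y - D y)) := by
    intro y
    simp only [Pi.add_apply, Pi.sub_apply]
    ring
  refine ⟨i.congr (.of_forall heq), ?_⟩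
  rw [← integral_congr_ae (.of_forall heq), integral_add' (((h₁.1.const_mul (a * c)).sub
    (h₂.1.const_mul a)).sub (h₃.1.const_mul c)) h₄.1, integral_sub' ((h₁.1.const_mul (a * c)).sub
    (h₂.1.const_mul a)) (h₃.1.const_mul c), integral_sub' (h₁.1.const_mul (a * c))
    (h₂.1.const_mul a), integral_const_mul, integral_const_mul, integral_const_mul,
    h₁.2, h₂.2, h₃.2, h₄.2]

/-- The Gamma factors common to all tangential Mellin transforms. -/
def gammaFactor (m γ : ℝ) : ℝ :=
  Real.Gamma (m + γ - 2) * Real.Gamma (m - 2) ^ 2 * Real.Gamma (m - 2 - γ) /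
    Real.Gamma (2 * m - 4)

lemma extConst_sq {n : ℕ} {γ : ℝ} (hγ : 0 < γ) (hn : 2 * γ < n) :
    extConst n γ ^ 2 = 4 * (2 ^ (1 - 2 * γ) / Real.Gamma γ ^ 2 *
      (dTwo n γ ^ 2 * 2 ^ ((n : ℝ) - 5))) := by
  have h1 : 0 < Real.Gamma (((n : ℝ) - 2 * γ) / 2) := Gamma_pos_of_pos (by linarith)
  have h2 : 0 < Real.Gamma (((n : ℝ) + 2 * γ) / 2) := Gamma_pos_of_pos (by linarith)
  have h3 := Gamma_pos_of_pos hγ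
  have hd : dTwo n γ = 2 * (Real.Gamma (((n : ℝ) + 2 * γ) / 2) /
      Real.Gamma (((n : ℝ) - 2 * γ) / 2)) ^ (((n : ℝ) - 2 * γ) / (4 * γ)) /
      Real.Gamma (((n : ℝ) - 2 * γ) / 2) := by
    rw [dTwo, div_rpow h2.le h1.le, show ((n : ℝ) + 2 * γ) / (4 * γ) =
      ((n : ℝ) - 2 * γ) / (4 * γ) + 1 by field_simp; ring, rpow_add_one h1.ne']
    field_simp
  have hp : extConst n γ = 2 ^ (((n : ℝ) - 2 * γ) / 2) * dTwo n γ / (2 * Real.Gamma γ) := by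
    rw [hd, extConst, png, cng, show (n : ℝ) / 2 - γ = ((n : ℝ) - 2 * γ) / 2 by ring,
      show (n : ℝ) / 2 + γ = ((n : ℝ) + 2 * γ) / 2 by ring]
    field_simp
  have h4 : ((2 : ℝ) ^ (((n : ℝ) - 2 * γ) / 2)) ^ 2 =
      16 * (2 ^ (1 - 2 * γ) * 2 ^ ((n : ℝ) - 5)) := by
    rw [← rpow_two, ← rpow_mul two_pos.le, ← rpow_add two_pos, show (16 : ℝ) = 2 ^ (4 : ℝ) by norm_num,
      ← rpow_add two_pos]
    ring_nf
  rw [hp, div_pow, mul_pow, mul_pow, h4]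
  field_simp
  ring

lemma hasRealMellin_besselInt_tangential {m γ : ℝ} (hγ : 0 < γ) (hm : γ + 2 < m) :
    HasRealMellin (fun l => besselInt (-γ - 1) l * besselInt (-γ - 1) l) (m + γ)
      ((m + γ - 1) * (m + γ - 2) * (m - 2) ^ 2 / ((2 * m - 3) * (2 * m - 4)) * gammaFactor m γ) ∧
    HasRealMellin (fun l => besselInt (-γ - 1) l * besselInt (-γ) l) (m + γ - 1)
      ((m + γ - 2) * (m - 2) / (2 * m - 4) * gammaFactor m γ) ∧
    HasRealMellin (fun l => besselInt (-γ) l * besselInt (-γ) l) (m + γ - 2)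
      (gammaFactor m γ) ∧
    HasRealMellin (fun l => besselInt γ l * besselInt γ l) (m - 1 - γ)
      ((m - 2 - γ) * (m - 2) ^ 2 * (m + γ - 2) / ((2 * m - 3) * (2 * m - 4)) *
        gammaFactor m γ) := by
  have e1 : Real.Gamma (m + γ - 1) = (m + γ - 2) * Real.Gamma (m + γ - 2) := by
    rw [← Gamma_add_one (by linarith)]; ring_nf
  have e2 : Real.Gamma (m + γ) = (m + γ - 1) * ((m + γ - 2) * Real.Gamma (m + γ - 2)) := by
    rw [← e1, ← Gamma_add_one (by linarith)]; ring_nf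
  have e3 : Real.Gamma (m - 1) = (m - 2) * Real.Gamma (m - 2) := by
    rw [← Gamma_add_one (by linarith)]; ring_nf
  have e4 : Real.Gamma (m - 1 - γ) = (m - 2 - γ) * Real.Gamma (m - 2 - γ) := by
    rw [← Gamma_add_one (by linarith)]; ring_nf
  have e5 : Real.Gamma (2 * m - 3) = (2 * m - 4) * Real.Gamma (2 * m - 4) := by
    rw [← Gamma_add_one (by linarith)]; ring_nf
  have e6 : Real.Gamma (2 * m - 2) = (2 * m - 3) * ((2 * m - 4) * Real.Gamma (2 * m - 4)) := by
    rw [← e5, ← Gamma_add_one (by linarith)]; ring_nf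
  have h1 : 2 * m - 4 ≠ 0 := by linarith
  have h2 : 2 * m - 3 ≠ 0 := by linarith
  have h3 := (Gamma_pos_of_pos (show 0 < 2 * m - 4 by linarith)).ne'
  unfold gammaFactor
  generalize hW : Real.Gamma (2 * m - 4) = W at *
  generalize hX : Real.Gamma (m + γ - 2) = X at *
  generalize hY : Real.Gamma (m - 2) = Y at *
  generalize hZ : Real.Gamma (m - 2 - γ) = Z at *
  refine ⟨hasRealMellin_besselInt_mul (by linarith) (by linarith) (by linarith) (by linarith) ?_,
    hasRealMellin_besselInt_mul (by linarith) (by linarith) (by linarith) (by linarith) ?_,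
    hasRealMellin_besselInt_mul (by linarith) (by linarith) (by linarith) (by linarith) ?_,
    hasRealMellin_besselInt_mul (by linarith) (by linarith) (by linarith) (by linarith) ?_⟩
  · rw [show -γ - 1 + (m + γ) = m - 1 by ring, show -γ - 1 + (-γ - 1) + (m + γ) = m - 2 - γ by ring,
      show -γ - 1 + (-γ - 1) + 2 * (m + γ) = 2 * m - 2 by ring, e2, e3, e6, hZ]
    field_simp
  · rw [show -γ - 1 + (m + γ - 1) = m - 2 by ring, show -γ + (m + γ - 1) = m - 1 by ring,
      show -γ - 1 + -γ + (m + γ - 1) = m - 2 - γ by ring,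
      show -γ - 1 + -γ + 2 * (m + γ - 1) = 2 * m - 3 by ring, e1, e3, e5, hY, hZ]
    field_simp
  · rw [show -γ + (m + γ - 2) = m - 2 by ring, show -γ + -γ + (m + γ - 2) = m - 2 - γ by ring,
      show -γ + -γ + 2 * (m + γ - 2) = 2 * m - 4 by ring, hW, hX, hY, hZ]
    ring
  · rw [show γ + (m - 1 - γ) = m - 1 by ring, show γ + γ + (m - 1 - γ) = m + γ - 1 by ring,
      show γ + γ + 2 * (m - 1 - γ) = 2 * m - 2 by ring, e1, e3, e4, e6]
    generalize 2 * m - 4 = p at h1 ⊢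
    generalize 2 * m - 3 = r at h2 ⊢
    field_simp

lemma hasRealMellin_besselInt_normal {γ a b q : ℝ} {i j k l : ℕ} (hγ : 0 < γ) (hγ1 : γ < 1)
    (hi : q = i + 1 - γ) (hj : a + q = j + 1) (hk : b + q = k + 1)
    (hl : a + b + q = l + γ) (hl0 : 0 < l) :
    HasRealMellin (fun y => besselInt a y * besselInt b y) q
      ((∏ x ∈ Finset.range i, (x + 1 - γ)) * j.factorial * k.factorial *
        (∏ x ∈ Finset.range (l - 1), (x + 1 + γ)) / (j + k + 1).factorial *
          (Real.Gamma (1 - γ) * Real.Gamma (1 + γ))) := by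
  have hprod : ∀ (i : ℕ) (c : ℝ), 0 < c →
      Real.Gamma (i + c) = (∏ x ∈ Finset.range i, (x + c)) * Real.Gamma c := by
    intro i c hc
    induction i with
    | zero => simp
    | succ i ih =>
      rw [Finset.prod_range_succ, mul_right_comm, ← ih, Nat.cast_succ, add_right_comm,
        Gamma_add_one (by positivity), mul_comm]
  obtain ⟨l, rfl⟩ : ∃ l', l = l' + 1 := ⟨l - 1, by omega⟩
  have hq : 0 < q := by
    rw [hi]
    have : (0 : ℝ) ≤ i := i.cast_nonneg
    linarith
  refine hasRealMellin_besselInt_mul hq (by rw [hj]; positivity) (by rw [hk]; positivity)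
    (by rw [hl]; positivity) ?_
  rw [show a + b + 2 * q = (j + k + 1 : ℕ) + 1 by push_cast; linarith, hj, hk, hl, hi,
    Gamma_nat_eq_factorial, Gamma_nat_eq_factorial, Gamma_nat_eq_factorial, add_sub_assoc,
    hprod i (1 - γ) (by linarith), Nat.cast_succ, add_assoc (l : ℝ) 1 γ,
    hprod l (1 + γ) (by linarith), Nat.add_sub_cancel]
  simp only [add_sub_assoc, add_assoc]
  ring

theorem stmt_19 (n : ℕ) (γ : ℝ) (hγ0 : 0 < γ) (hγ1 : γ < 1) (hn : 2 * γ + 8 < (n : ℝ)) :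
    (∫ xN in Set.Ioi (0 : ℝ), ∫ x : EuclideanSpace ℝ (Fin n),
        xN ^ (3 - 2 * γ) * ‖x‖ ^ 2 *
          ‖fderiv ℝ (fun y => bubbleExt n γ 1 0 y xN) x‖ ^ 2) =
      sphereConst n *
        ((1 - γ ^ 2) * 2 * ((n : ℝ) + 2) *
            (5 * ((n : ℝ) - 1) * ((n : ℝ) - 3) + (1 - 4 * γ ^ 2)) /
          (15 * ((n : ℝ) - 4) * ((n : ℝ) - 2 * γ - 4) * ((n : ℝ) + 2 * γ - 4))) *
        (Aone γ * Btwo n γ) ∧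
    (∫ xN in Set.Ioi (0 : ℝ), ∫ x : EuclideanSpace ℝ (Fin n),
        xN ^ (3 - 2 * γ) * ‖x‖ ^ 2 *
          (deriv (fun t => bubbleExt n γ 1 0 x t) xN) ^ 2) =
      sphereConst n *
        (2 * (1 - γ) * (2 - γ) *
            (5 * ((n : ℝ) - 1) * ((n : ℝ) - 2) * ((n : ℝ) - 3) -
              (1 - 2 * γ) * (3 * (n : ℝ) - 14 - 2 * γ * ((n : ℝ) + 2))) /
          (15 * ((n : ℝ) - 4) * ((n : ℝ) - 2 * γ - 4) * ((n : ℝ) + 2 * γ - 4))) *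
        (Aone γ * Btwo n γ) := by
  obtain ⟨m, hm⟩ : ∃ m : ℝ, (n : ℝ) = 2 * m := ⟨n / 2, by ring⟩
  have hm2 : (n : ℝ) / 2 = m := by rw [hm]; ring
  obtain ⟨hv₁, hv₂, hv₃, hB⟩ := hasRealMellin_besselInt_tangential (m := m) hγ0 (by linarith)
  have hP := extConst_sq hγ0 (show 2 * γ < n by linarith)
  set K := gammaFactor m γ
  set L := Real.Gamma (1 - γ) * Real.Gamma (1 + γ) with hL
  have hN : ∀ {a b q : ℝ} (i j k l : ℕ), _ := fun {a b q} i j k l =>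
    hasRealMellin_besselInt_normal (γ := γ) (a := a) (b := b) (q := q) (i := i) (j := j) (k := k)
      (l := l) hγ0 hγ1
  have hAv : Aone γ = 2 ^ (1 - 2 * γ) / Real.Gamma γ ^ 2 * L := by
    have := (hN (a := γ) (b := γ) (q := 1 - γ) 0 0 0 1 (by push_cast; ring) (by push_cast; ring)
      (by push_cast; ring) (by push_cast; ring) one_pos).2
    rw [show 1 - γ - 1 = -γ by ring] at this
    rw [Aone_eq hγ0, this]
    norm_num [hL]
  have hBv : Btwo n γ = dTwo n γ ^ 2 * 2 ^ ((n : ℝ) - 5) * ((m - 2 - γ) * (m - 2) ^ 2 *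
      (m + γ - 2) / ((2 * m - 3) * (2 * m - 4)) * K) := by
    have := hB.2
    rw [show m - 1 - γ - 1 = (n : ℝ) / 2 - 2 - γ by rw [hm2]; ring] at this
    rw [Btwo_eq, this]
  have h1 : m - 2 ≠ 0 := by linarith
  have h2 : 2 * m - 3 ≠ 0 := by linarith
  have h3 : m - 2 - γ ≠ 0 := by linarith
  have h4 : m + γ - 2 ≠ 0 := by linarith
  have h5 : 2 * m - 4 = 2 * (m - 2) := by ring
  have h6 : 2 * m - 2 * γ - 4 = 2 * (m - 2 - γ) := by ring
  have h7 : 2 * m + 2 * γ - 4 = 2 * (m + γ - 2) := by ring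
  have hpow : ∀ t : ℝ, 0 < t → ∀ β : ℝ, (t ^ 2) ^ (-β) = t ^ (-(2 * β)) := fun t ht β => by
    rw [← rpow_two, ← rpow_mul ht.le]
    ring_nf
  constructor
  · have hw₁ := hN (a := γ) (b := γ) (q := 2 - γ) 1 1 1 2 (by push_cast; ring) (by push_cast; ring)
      (by push_cast; ring) (by push_cast; ring) two_pos
    have hw₂ := hN (a := γ) (b := γ - 1) (q := 2 - γ + 1) 2 2 1 2 (by push_cast; ring)
      (by push_cast; ring) (by push_cast; ring) (by push_cast; ring) two_pos
    have hw₃ := hN (a := γ - 1) (b := γ - 1) (q := 2 - γ + 2) 3 2 2 2 (by push_cast; ring)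
      (by push_cast; ring) (by push_cast; ring) (by push_cast; ring) two_pos
    have main := integral_integral_sq_add (measurable_besselInt _) (measurable_besselInt _)
      (measurable_besselInt _) (measurable_besselInt _) hv₁ hv₂ hv₃ hw₁ hw₂ hw₃
    have hslice : ∀ᵐ t ∂halfLine, ∫ x : EuclideanSpace ℝ (Fin n), t ^ (3 - 2 * γ) * ‖x‖ ^ 2 *
        ‖fderiv ℝ (fun y => bubbleExt n γ 1 0 y t) x‖ ^ 2 =
        2 * extConst n γ ^ 2 * sphereConst n * (t ^ (2 * (2 - γ) - 1) *
          ∫ l, l ^ (m + γ + (2 - γ) - 1) * (besselInt (-γ - 1) l * besselInt γ (t ^ 2 * l) +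
            t ^ 2 * (besselInt (-γ) l * besselInt (γ - 1) (t ^ 2 * l))) ^ 2 ∂halfLine) := by
      filter_upwards [ae_halfLine_pos] with t ht
      have ht2 : 0 < t ^ 2 := by positivity
      rw [integral_slice_fderiv hγ0 (by linarith) ht, hm2, mul_assoc _ (t ^ _)]
      congr 1
      rw [← integral_const_mul, ← integral_const_mul]
      refine integral_congr_ae ?_
      filter_upwards [ae_halfLine_pos] with l hl
      rw [(integrable_mixDensity_mul_width ht2 hl).2, show 1 - γ = -γ + 1 by ring,
        rpow_add_one ht2.ne', hpow t ht, show 3 + 2 * γ = 2 * (2 - γ) - 1 + 2 * γ + 2 * γ by ring,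
        rpow_add ht, rpow_add ht, rpow_neg ht.le,
        show m + γ + (2 - γ) - 1 = m + 1 by ring]
      have := (rpow_pos_of_pos ht (2 * γ)).ne'
      field_simp
    rw [integral_congr_ae hslice, integral_const_mul, main, hAv, hBv, hP, hm, ← hL, h5, h6, h7]
    generalize (2 : ℝ) ^ (1 - 2 * γ) / Real.Gamma γ ^ 2 = c
    generalize dTwo n γ ^ 2 * (2 : ℝ) ^ (2 * m - 5) = d
    clear_value L K
    simp only [Finset.prod_range_succ, Finset.prod_range_zero, Nat.factorial]
    push_cast
    field_simp
    ring
  · have g₁ : HasRealMellin (fun y => (γ * besselInt γ y - besselInt (γ + 1) y) *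
        (γ * besselInt γ y - besselInt (γ + 1) y)) (1 - γ) _ := .mul_sub_mul_mul_sub
      (hN 0 0 0 1 (by push_cast; ring) (by push_cast; ring) (by push_cast; ring)
        (by push_cast; ring) one_pos)
      (hN 0 0 1 2 (by push_cast; ring) (by push_cast; ring) (by push_cast; ring)
        (by push_cast; ring) two_pos)
      (hN 0 1 0 2 (by push_cast; ring) (by push_cast; ring) (by push_cast; ring)
        (by push_cast; ring) two_pos)
      (hN 0 1 1 3 (by push_cast; ring) (by push_cast; ring) (by push_cast; ring)
        (by push_cast; ring) three_pos)
    have g₂ : HasRealMellin (fun y => (γ * besselInt γ y - besselInt (γ + 1) y) *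
        (γ * besselInt (γ - 1) y - besselInt γ y)) (1 - γ + 1) _ := .mul_sub_mul_mul_sub
      (hN 1 1 0 1 (by push_cast; ring) (by push_cast; ring) (by push_cast; ring)
        (by push_cast; ring) one_pos)
      (hN 1 1 1 2 (by push_cast; ring) (by push_cast; ring) (by push_cast; ring)
        (by push_cast; ring) two_pos)
      (hN 1 2 0 2 (by push_cast; ring) (by push_cast; ring) (by push_cast; ring)
        (by push_cast; ring) two_pos)
      (hN 1 2 1 3 (by push_cast; ring) (by push_cast; ring) (by push_cast; ring)
        (by push_cast; ring) three_pos)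
    have g₃ : HasRealMellin (fun y => (γ * besselInt (γ - 1) y - besselInt γ y) *
        (γ * besselInt (γ - 1) y - besselInt γ y)) (1 - γ + 2) _ := .mul_sub_mul_mul_sub
      (hN 2 1 1 1 (by push_cast; ring) (by push_cast; ring) (by push_cast; ring)
        (by push_cast; ring) one_pos)
      (hN 2 1 2 2 (by push_cast; ring) (by push_cast; ring) (by push_cast; ring)
        (by push_cast; ring) two_pos)
      (hN 2 2 1 2 (by push_cast; ring) (by push_cast; ring) (by push_cast; ring)
        (by push_cast; ring) two_pos)
      (hN 2 2 2 3 (by push_cast; ring) (by push_cast; ring) (by push_cast; ring)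
        (by push_cast; ring) three_pos)
    have hmeas := measurable_besselInt
    have main := integral_integral_sq_add (measurable_besselInt _) (measurable_besselInt _)
      (((hmeas γ).const_mul γ).sub (hmeas (γ + 1))) (((hmeas (γ - 1)).const_mul γ).sub (hmeas γ))
      hv₁ hv₂ hv₃ g₁ g₂ g₃
    simp only [Pi.sub_apply] at main
    have hslice : ∀ᵐ t ∂halfLine, ∫ x : EuclideanSpace ℝ (Fin n), t ^ (3 - 2 * γ) * ‖x‖ ^ 2 *
        deriv (fun t => bubbleExt n γ 1 0 x t) t ^ 2 =
        2 * extConst n γ ^ 2 * sphereConst n * (t ^ (2 * (1 - γ) - 1) *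
          ∫ l, l ^ (m + γ + (1 - γ) - 1) * (besselInt (-γ - 1) l *
            (γ * besselInt γ (t ^ 2 * l) - besselInt (γ + 1) (t ^ 2 * l)) +
            t ^ 2 * (besselInt (-γ) l * (γ * besselInt (γ - 1) (t ^ 2 * l) -
              besselInt γ (t ^ 2 * l)))) ^ 2 ∂halfLine) := by
      filter_upwards [ae_halfLine_pos] with t ht
      have ht2 : 0 < t ^ 2 := by positivity
      rw [integral_slice_deriv hγ0 (by linarith) ht, hm2, mul_assoc _ (t ^ _)]
      congr 1
      rw [← integral_const_mul, ← integral_const_mul]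
      refine integral_congr_ae ?_
      filter_upwards [ae_halfLine_pos] with l hl
      obtain ⟨i₁, j₁⟩ := integrable_mixDensity_mul_width (γ := γ) (β := γ) ht2 hl
      obtain ⟨i₂, j₂⟩ := integrable_mixDensity_mul_width (γ := γ) (β := γ + 1) ht2 hl
      have hsub : ∫ z, (γ * mixDensity γ γ (t ^ 2) z - t ^ 2 * mixDensity γ (γ + 1) (t ^ 2) z) *
          width z * rexp (-(l * width z)) ∂quadrant =
          γ * (∫ z, mixDensity γ γ (t ^ 2) z * width z * rexp (-(l * width z)) ∂quadrant) -
          t ^ 2 * ∫ z, mixDensity γ (γ + 1) (t ^ 2) z * width z * rexp (-(l * width z))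
            ∂quadrant := by
        rw [← integral_const_mul, ← integral_const_mul,
          ← integral_sub (i₁.const_mul _) (i₂.const_mul _)]
        congr 1 with z
        ring
      rw [hsub, j₁, j₂, show 1 - (γ + 1) = -γ by ring, show γ + 1 - 1 = γ by ring,
        show 1 - γ = -γ + 1 by ring, show -(γ + 1) = -γ - 1 by ring,
        rpow_add_one ht2.ne', rpow_sub_one ht2.ne', hpow t ht,
        show 1 + 2 * γ = 2 * (-γ + 1) - 1 + 2 * γ + 2 * γ by ring,
        rpow_add ht, rpow_add ht, rpow_neg ht.le, show m + γ + (-γ + 1) - 1 = m by ring]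
      have := (rpow_pos_of_pos ht (2 * γ)).ne'
      field_simp
      ring
    rw [integral_congr_ae hslice, integral_const_mul, main, hAv, hBv, hP, hm, ← hL, h5, h6, h7]
    generalize (2 : ℝ) ^ (1 - 2 * γ) / Real.Gamma γ ^ 2 = c
    generalize dTwo n γ ^ 2 * (2 : ℝ) ^ (2 * m - 5) = d
    clear_value L K
    simp only [Finset.prod_range_succ, Finset.prod_range_zero, Nat.factorial]
    push_cast
    field_simp
    ring

end
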